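/- arXiv:1102.3822 — 3 statements merged into one kernel-verified Lean document; each statement's English description precedes it below -/
import Mathlib

section
/- Theorem (fast convergence of Rational Pavlov on the cycle). For every p ∈ [0.870, 1] there exists a constant ω > 0 such that for every n ≥ 3, every initial configuration, and every ε ∈ (0,1): if t ≥ (n/ω)·log(n/ε), then the probability that S_t is not the all-cooperate configuration is at most ε (equivalently, the all-cooperate state is reached within time (n/ω)·log(n/ε) except with probability at most ε). -/
open scoped Classical

/-- A configuration of the `n`-cycle: `true` = cooperate, `false` = defect. -/
abbrev Config (n : ℕ) := ZMod n → Bool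

/-- Probability that, when the edge `{i, i+1}` is selected for play, the
Rational Pavlov update turns configuration `S` into configuration `T`. -/
noncomputable def rpUpdProb (p : ℝ) {n : ℕ} (S : Config n) (i : ZMod n) (T : Config n) : ℝ :=
  if S i = true ∧ S (i + 1) = true then
    (if T = S then 1 else 0)
  else if S i = false ∧ S (i + 1) = false then
    (if ∀ j : ZMod n, j ≠ i → j ≠ i + 1 → T j = S j then
      (if T i = true then p else 1 - p) * (if T (i + 1) = true then p else 1 - p)
    else 0)
  else
    (if T = Function.update (Function.update S i false) (i + 1) false then 1 else 0)

/-- One-step transition probability of the Rational Pavlov chain on the `n`-cycle: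
an edge `{i, i+1}` is chosen uniformly at random and the two players update. -/
noncomputable def rpStepProb (p : ℝ) {n : ℕ} [NeZero n] (S T : Config n) : ℝ :=
  (1 / (n : ℝ)) * ∑ i : ZMod n, rpUpdProb p S i T

/-- Probability that the Rational Pavlov chain started at `S0`, run for `t` steps,
produces a trajectory `σ : Fin (t+1) → Config n` satisfying the event `E`. -/
noncomputable def rpTrajProb (p : ℝ) {n : ℕ} [NeZero n] (S0 : Config n) (t : ℕ)
    (E : (Fin (t + 1) → Config n) → Prop) : ℝ :=
  ∑ σ : Fin (t + 1) → Config n,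
    (if σ 0 = S0 ∧ E σ then ∏ s : Fin t, rpStepProb p (σ s.castSucc) (σ s.succ) else 0)

/-- Probability that the Rational Pavlov update sends a pair in state `(x, y)` to `(a, b)`. -/
noncomputable def pairProb (p : ℝ) : Bool → Bool → Bool → Bool → ℝ
  | true, true, a, b => if a && b then 1 else 0
  | false, false, a, b => (if a then p else 1 - p) * (if b then p else 1 - p)
  | _, _, a, b => if a || b then 0 else 1

/-- The configuration obtained from `S` by giving `i` and `i + 1` the states `a` and `b`. -/
def setPair {n : ℕ} (S : Config n) (i : ZMod n) (a b : Bool) : Config n :=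
  Function.update (Function.update S i a) (i + 1) b

/-- `n` times the expected one-step change of the potential `Φ` from the configuration `S`. -/
noncomputable def rpDrift (p : ℝ) {n : ℕ} [NeZero n] (Φ : Config n → ℝ) (S : Config n) : ℝ :=
  ∑ i, ∑ a, ∑ b, pairProb p (S i) (S (i + 1)) a b * (Φ (setPair S i a b) - Φ S)

theorem sum_pairProb (p : ℝ) (x y : Bool) : ∑ a, ∑ b, pairProb p x y a b = 1 := by
  cases x <;> cases y <;> simp only [Fintype.sum_bool, pairProb] <;> simp
  ring

theorem rpUpdProb_nonneg {p : ℝ} (h0 : 0 ≤ p) (h1 : p ≤ 1) {n : ℕ} (S : Config n) (i : ZMod n)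
    (T : Config n) : 0 ≤ rpUpdProb p S i T := by
  have h2 : 0 ≤ 1 - p := by linarith
  unfold rpUpdProb
  split_ifs <;> positivity

theorem rpStepProb_nonneg {p : ℝ} (h0 : 0 ≤ p) (h1 : p ≤ 1) {n : ℕ} [NeZero n]
    (S T : Config n) : 0 ≤ rpStepProb p S T :=
  mul_nonneg (by positivity) (Finset.sum_nonneg fun i _ => rpUpdProb_nonneg h0 h1 S i T)

theorem setPair_self {n : ℕ} (S : Config n) (i : ZMod n) : setPair S i (S i) (S (i + 1)) = S := by
  simp [setPair]

theorem eq_setPair_iff {n : ℕ} {i : ZMod n} (hi : i + 1 ≠ i) (S T : Config n) (a b : Bool) :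
    T = setPair S i a b ↔
      (∀ j, j ≠ i → j ≠ i + 1 → T j = S j) ∧ T i = a ∧ T (i + 1) = b := by
  constructor
  · rintro rfl
    refine ⟨fun j h1 h2 => ?_, ?_, ?_⟩ <;> simp [setPair, *, Ne.symm hi]
  · rintro ⟨h, rfl, rfl⟩
    funext j
    by_cases h2 : j = i + 1
    · simp [setPair, h2]
    by_cases h1 : j = i
    · subst h1
      simp [setPair, h2]
    · simp [setPair, h1, h2, h j h1 h2]

theorem rpUpdProb_eq_sum (p : ℝ) {n : ℕ} {i : ZMod n} (hi : i + 1 ≠ i) (S T : Config n) :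
    rpUpdProb p S i T =
      ∑ a, ∑ b, pairProb p (S i) (S (i + 1)) a b * if T = setPair S i a b then 1 else 0 := by
  have hS := setPair_self S i
  unfold rpUpdProb
  cases hx : S i <;> cases hy : S (i + 1)
  · simp only [eq_setPair_iff hi]
    by_cases h : ∀ j, j ≠ i → j ≠ i + 1 → T j = S j
    · simp only [if_pos h, and_iff_right h]
      cases T i <;> cases T (i + 1) <;> simp [pairProb]
    · simp [h]
  · simp [pairProb]
    congr
  · simp [pairProb]
    congr
  · rw [hx, hy] at hS
    simp [pairProb, hS]

theorem sum_rpStepProb_mul (p : ℝ) {n : ℕ} [NeZero n] (hn : 2 ≤ n) (Φ : Config n → ℝ)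
    (S : Config n) : ∑ T, rpStepProb p S T * Φ T = Φ S + 1 / n * rpDrift p Φ S := by
  have : Fact (1 < n) := ⟨hn⟩
  have hn0 : (n : ℝ) ≠ 0 := NeZero.ne _
  have hupd (i : ZMod n) : ∑ T, rpUpdProb p S i T * Φ T =
      Φ S + ∑ a, ∑ b, pairProb p (S i) (S (i + 1)) a b * (Φ (setPair S i a b) - Φ S) := by
    have hi : i + 1 ≠ i := by simp
    simp_rw [rpUpdProb_eq_sum p hi, mul_sub, Finset.sum_sub_distrib, ← Finset.sum_mul,
      sum_pairProb, Finset.sum_mul]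
    rw [Finset.sum_comm]
    simp_rw [Finset.sum_comm (s := (Finset.univ : Finset (Config n)))]
    simp
  unfold rpStepProb rpDrift
  simp_rw [mul_assoc, ← Finset.mul_sum, Finset.sum_mul]
  rw [Finset.sum_comm]
  simp_rw [hupd, Finset.sum_add_distrib]
  simp [mul_add, hn0]

/-- Expected value of `Φ` after `t` steps of the chain, as a sum over trajectories. -/
noncomputable def rpExpect (p : ℝ) {n : ℕ} [NeZero n] (Φ : Config n → ℝ) (S₀ : Config n)
    (t : ℕ) : ℝ :=
  ∑ σ : Fin (t + 1) → Config n, if σ 0 = S₀ then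
    (∏ s : Fin t, rpStepProb p (σ s.castSucc) (σ s.succ)) * Φ (σ (Fin.last t)) else 0

theorem rpExpect_zero (p : ℝ) {n : ℕ} [NeZero n] (Φ : Config n → ℝ) (S₀ : Config n) :
    rpExpect p Φ S₀ 0 = Φ S₀ := by
  unfold rpExpect
  rw [← (Equiv.funUnique (Fin 1) (Config n)).symm.sum_comp]
  simp

theorem rpExpect_succ (p : ℝ) {n : ℕ} [NeZero n] (Φ : Config n → ℝ) (S₀ : Config n) (t : ℕ) :
    rpExpect p Φ S₀ (t + 1) = ∑ T, rpStepProb p S₀ T * rpExpect p Φ T t := by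
  unfold rpExpect
  rw [← (Fin.consEquiv fun _ : Fin (t + 1 + 1) => Config n).sum_comp, Fintype.sum_prod_type,
    Finset.sum_comm]
  simp_rw [Finset.mul_sum]
  rw [Finset.sum_comm (γ := Config n)]
  refine Finset.sum_congr rfl fun τ _ => ?_
  simp [Fin.consEquiv, Fin.prod_univ_succ (n := t), ← Fin.succ_last, mul_assoc]

theorem rpExpect_le {p : ℝ} (h0 : 0 ≤ p) (h1 : p ≤ 1) {n : ℕ} [NeZero n] {Φ : Config n → ℝ}
    {ρ : ℝ} (hρ : 0 ≤ ρ) (h : ∀ S, ∑ T, rpStepProb p S T * Φ T ≤ ρ * Φ S) (t : ℕ)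
    (S₀ : Config n) : rpExpect p Φ S₀ t ≤ ρ ^ t * Φ S₀ := by
  induction t generalizing S₀ with
  | zero => simp [rpExpect_zero]
  | succ t ih =>
    rw [rpExpect_succ]
    calc ∑ T, rpStepProb p S₀ T * rpExpect p Φ T t
        ≤ ∑ T, rpStepProb p S₀ T * (ρ ^ t * Φ T) := by
          gcongr with T
          · exact rpStepProb_nonneg h0 h1 S₀ T
          · exact ih T
      _ = ρ ^ t * ∑ T, rpStepProb p S₀ T * Φ T := by
          rw [Finset.mul_sum]
          exact Finset.sum_congr rfl fun T _ => by ring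
      _ ≤ ρ ^ t * (ρ * Φ S₀) := by gcongr; exact h S₀
      _ = ρ ^ (t + 1) * Φ S₀ := by ring

theorem rpTrajProb_le_rpExpect {p : ℝ} (h0 : 0 ≤ p) (h1 : p ≤ 1) {n : ℕ} [NeZero n]
    {Φ : Config n → ℝ} (hΦ : ∀ S, 0 ≤ Φ S) (hΦ1 : ∀ S, S ≠ (fun _ => true) → 1 ≤ Φ S)
    (S₀ : Config n) (t : ℕ) :
    rpTrajProb p S₀ t (fun σ => σ (Fin.last t) ≠ fun _ => true) ≤ rpExpect p Φ S₀ t := by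
  refine Finset.sum_le_sum fun σ _ => ?_
  have hprod : 0 ≤ ∏ s : Fin t, rpStepProb p (σ s.castSucc) (σ s.succ) :=
    Finset.prod_nonneg fun s _ => rpStepProb_nonneg h0 h1 _ _
  split_ifs with hE hS hS
  · exact le_mul_of_one_le_right hprod (hΦ1 _ hE.2)
  · exact absurd hE.1 hS
  · exact mul_nonneg hprod (hΦ _)
  · exact le_rfl

/-- A potential whose drift is at most `-Φ / 100` forces convergence in time `O(n log (n / ε))`. -/
theorem rpTrajProb_le_of_rpDrift_le {p : ℝ} (h0 : 0 ≤ p) (h1 : p ≤ 1) {n : ℕ} [NeZero n]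
    (hn : 2 ≤ n) {Φ : Config n → ℝ} (hΦ : ∀ S, 0 ≤ Φ S)
    (hΦ1 : ∀ S, S ≠ (fun _ => true) → 1 ≤ Φ S) (hΦn : ∀ S, Φ S ≤ (n : ℝ) ^ 4)
    (hdrift : ∀ S, rpDrift p Φ S ≤ -(Φ S / 100)) (S₀ : Config n) {ε : ℝ}
    (hε : ε ∈ Set.Ioo (0 : ℝ) 1) {t : ℕ}
    (ht : (n : ℝ) / (1 / 400) * Real.log (n / ε) ≤ t) :
    rpTrajProb p S₀ t (fun σ => σ (Fin.last t) ≠ fun _ => true) ≤ ε := by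
  obtain ⟨hε0, hε1⟩ := hε
  have hn2 : (2 : ℝ) ≤ n := by exact_mod_cast hn
  have hn0 : (0 : ℝ) < n := by linarith
  have hc : 1 / (100 * n) ≤ (1 : ℝ) := by
    rw [div_le_one (by positivity)]
    linarith
  have hρ : 0 ≤ 1 - 1 / (100 * (n : ℝ)) := by linarith
  have hstep (S : Config n) :
      ∑ T, rpStepProb p S T * Φ T ≤ (1 - 1 / (100 * (n : ℝ))) * Φ S := by
    rw [sum_rpStepProb_mul p hn]
    calc Φ S + 1 / n * rpDrift p Φ S ≤ Φ S + 1 / n * -(Φ S / 100) := by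
          gcongr
          exact hdrift S
      _ = (1 - 1 / (100 * (n : ℝ))) * Φ S := by
          field_simp
          ring
  have hexp : (1 - 1 / (100 * (n : ℝ))) ^ t ≤ (ε / n) ^ 4 :=
    calc (1 - 1 / (100 * (n : ℝ))) ^ t ≤ Real.exp (-(1 / (100 * n))) ^ t := by
          gcongr
          exact Real.one_sub_le_exp_neg _
      _ = Real.exp (-(t / (100 * n))) := by
          rw [← Real.exp_nat_mul]
          ring_nf
      _ ≤ Real.exp (-(4 * Real.log (n / ε))) := by
          gcongr
          rw [le_div_iff₀ (by positivity)]
          linarith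
      _ = (ε / n) ^ 4 := by
          rw [← mul_neg, ← Real.log_inv, inv_div]
          have := Real.exp_nat_mul (Real.log (ε / n)) 4
          rw [Real.exp_log (by positivity)] at this
          exact_mod_cast this
  calc rpTrajProb p S₀ t (fun σ => σ (Fin.last t) ≠ fun _ => true)
      ≤ rpExpect p Φ S₀ t := rpTrajProb_le_rpExpect h0 h1 hΦ hΦ1 S₀ t
    _ ≤ (1 - 1 / (100 * (n : ℝ))) ^ t * Φ S₀ := rpExpect_le h0 h1 hρ hstep t S₀
    _ ≤ (ε / n) ^ 4 * (n : ℝ) ^ 4 := by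
        gcongr
        exacts [hΦ _, hΦn _]
    _ = ε ^ 4 := by field_simp
    _ ≤ ε := pow_le_of_le_one hε0.le hε1.le (by norm_num)

/-- Potential of a window of four consecutive states. -/
def windowPot : Bool → Bool → Bool → Bool → ℝ
  | true, true, true, true => 0
  | true, true, true, false | false, true, true, true => 82
  | true, true, false, true | true, false, true, true => 102
  | true, true, false, false | false, false, true, true => 60
  | true, false, true, false | false, true, false, true => 105
  | true, false, false, true => 79
  | true, false, false, false | false, false, false, true => 105
  | false, true, true, false => 120
  | false, true, false, false | false, false, true, false => 101
  | false, false, false, false => 93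

/-- Telescoping correction that certifies the negative drift of the window potential. -/
def windowCorr : Bool → Bool → Bool → Bool → Bool → ℝ
  | false, true, true, false, false => 51
  | false, false, true, true, false => -51
  | true, false, false, true, false => -26
  | false, true, false, false, true => 26
  | true, true, false, false, false => -36
  | false, false, false, true, true => 36
  | true, true, true, false, false => 9
  | false, false, true, true, true => -9
  | true, true, true, false, true => -62
  | true, false, true, true, true => 62
  | true, true, true, true, false => -82
  | false, true, true, true, true => 82
  | _, _, _, _, _ => 0

/-- Contribution to the drift of the window `(x₁, x₂, x₃, x₄)`, by the five edges meeting it. -/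
noncomputable def windowDrift (p : ℝ) (x₀ x₁ x₂ x₃ x₄ x₅ : Bool) : ℝ :=
  ∑ a, ∑ b, pairProb p x₀ x₁ a b * (windowPot b x₂ x₃ x₄ - windowPot x₁ x₂ x₃ x₄) +
  ∑ a, ∑ b, pairProb p x₁ x₂ a b * (windowPot a b x₃ x₄ - windowPot x₁ x₂ x₃ x₄) +
  ∑ a, ∑ b, pairProb p x₂ x₃ a b * (windowPot x₁ a b x₄ - windowPot x₁ x₂ x₃ x₄) +
  ∑ a, ∑ b, pairProb p x₃ x₄ a b * (windowPot x₁ x₂ a b - windowPot x₁ x₂ x₃ x₄) +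
  ∑ a, ∑ b, pairProb p x₄ x₅ a b * (windowPot x₁ x₂ x₃ a - windowPot x₁ x₂ x₃ x₄)

set_option maxHeartbeats 4000000 in
theorem windowDrift_le {p : ℝ} (hp : p ∈ Set.Icc (0.870 : ℝ) 1) (x₀ x₁ x₂ x₃ x₄ x₅ : Bool) :
    windowDrift p x₀ x₁ x₂ x₃ x₄ x₅ ≤ windowCorr x₀ x₁ x₂ x₃ x₄ - windowCorr x₁ x₂ x₃ x₄ x₅ -
      windowPot x₁ x₂ x₃ x₄ / 100 := by
  obtain ⟨h0, h1⟩ := hp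
  norm_num at h0
  have h2 := mul_nonneg (sub_nonneg.2 h0) (sub_nonneg.2 h1)
  have h3 := mul_nonneg (sub_nonneg.2 h0) (sub_nonneg.2 h0)
  have h4 := mul_nonneg (sub_nonneg.2 h1) (sub_nonneg.2 h1)
  cases x₀ <;> cases x₁ <;> cases x₂ <;> cases x₃ <;> cases x₄ <;> cases x₅ <;>
    simp [windowDrift, pairProb, windowPot, windowCorr] <;> nlinarith only [h0, h1, h2, h3, h4]

/-- The sum of the window potentials around the cycle. -/
noncomputable def cyclePot {n : ℕ} [NeZero n] (S : Config n) : ℝ :=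
  ∑ i, windowPot (S i) (S (i + 1)) (S (i + 2)) (S (i + 3))

theorem windowPot_nonneg (a b c d : Bool) : 0 ≤ windowPot a b c d := by
  cases a <;> cases b <;> cases c <;> cases d <;> norm_num [windowPot]

theorem windowPot_le (a b c d : Bool) : windowPot a b c d ≤ 120 := by
  cases a <;> cases b <;> cases c <;> cases d <;> norm_num [windowPot]

theorem one_le_windowPot (b c d : Bool) : 1 ≤ windowPot false b c d := by
  cases b <;> cases c <;> cases d <;> norm_num [windowPot]

theorem cyclePot_nonneg {n : ℕ} [NeZero n] (S : Config n) : 0 ≤ cyclePot S :=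
  Finset.sum_nonneg fun _ _ => windowPot_nonneg _ _ _ _

theorem one_le_cyclePot {n : ℕ} [NeZero n] {S : Config n} (hS : S ≠ fun _ => true) :
    1 ≤ cyclePot S := by
  obtain ⟨i, hi⟩ := Function.ne_iff.1 hS
  have hi : S i = false := by simpa using hi
  calc (1 : ℝ) ≤ windowPot (S i) (S (i + 1)) (S (i + 2)) (S (i + 3)) := by
        rw [hi]
        exact one_le_windowPot _ _ _
    _ ≤ cyclePot S := Finset.single_le_sum
        (f := fun i => windowPot (S i) (S (i + 1)) (S (i + 2)) (S (i + 3)))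
        (fun _ _ => windowPot_nonneg _ _ _ _) (Finset.mem_univ i)

theorem cyclePot_le {n : ℕ} [NeZero n] (hn : 5 ≤ n) (S : Config n) :
    cyclePot S ≤ (n : ℝ) ^ 4 := by
  have hn5 : (5 : ℝ) ≤ n := by exact_mod_cast hn
  calc cyclePot S ≤ ∑ _i : ZMod n, (120 : ℝ) :=
        Finset.sum_le_sum fun _ _ => windowPot_le _ _ _ _
    _ = n * 120 := by simp [ZMod.card]
    _ ≤ n * (n : ℝ) ^ 3 := by
        gcongr
        calc (120 : ℝ) ≤ 5 ^ 3 := by norm_num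
          _ ≤ (n : ℝ) ^ 3 := by gcongr
    _ = (n : ℝ) ^ 4 := by ring

theorem cyclePot_eq_shift {n : ℕ} [NeZero n] (S : Config n) :
    cyclePot S = ∑ i, windowPot (S (i + 1)) (S (i + 2)) (S (i + 3)) (S (i + 4)) := by
  rw [cyclePot, ← Equiv.sum_comp (Equiv.addRight (1 : ZMod n))]
  refine Finset.sum_congr rfl fun i _ => ?_
  simp only [Equiv.coe_addRight, add_assoc]
  norm_num

theorem rpDrift_cyclePot (p : ℝ) {n : ℕ} [NeZero n] (hn : 5 ≤ n) (S : Config n) :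
    rpDrift p cyclePot S = ∑ i, windowDrift p (S i) (S (i + 1)) (S (i + 2)) (S (i + 3))
      (S (i + 4)) (S (i + 5)) := by
  have hne (k : ℕ) (hk : 0 < k) (hk5 : k < 5) : (k : ZMod n) ≠ 0 := by
    rw [Ne, ZMod.natCast_eq_zero_iff]
    exact fun h => absurd (Nat.le_of_dvd hk h) (by omega)
  have h1 : (1 : ZMod n) ≠ 0 := by exact_mod_cast hne 1 (by norm_num) (by norm_num)
  have h2 : (2 : ZMod n) ≠ 0 := by exact_mod_cast hne 2 (by norm_num) (by norm_num)
  have h3 : (3 : ZMod n) ≠ 0 := by exact_mod_cast hne 3 (by norm_num) (by norm_num)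
  have h4 : (4 : ZMod n) ≠ 0 := by exact_mod_cast hne 4 (by norm_num) (by norm_num)
  have h12 : (1 : ZMod n) ≠ 2 := fun h => h1 (by linear_combination -h)
  have h13 : (1 : ZMod n) ≠ 3 := fun h => h2 (by linear_combination -h)
  have h14 : (1 : ZMod n) ≠ 4 := fun h => h3 (by linear_combination -h)
  have h23 : (2 : ZMod n) ≠ 3 := fun h => h1 (by linear_combination -h)
  have h24 : (2 : ZMod n) ≠ 4 := fun h => h2 (by linear_combination -h)
  have h34 : (3 : ZMod n) ≠ 4 := fun h => h1 (by linear_combination -h)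
  have h15 : (1 : ZMod n) ≠ 5 := fun h => h4 (by linear_combination -h)
  have h25 : (2 : ZMod n) ≠ 5 := fun h => h3 (by linear_combination -h)
  have h35 : (3 : ZMod n) ≠ 5 := fun h => h2 (by linear_combination -h)
  have h45 : (4 : ZMod n) ≠ 5 := fun h => h1 (by linear_combination -h)
  have e2 (i : ZMod n) : i + 1 + 1 = i + 2 := by ring
  have e3 (i : ZMod n) : i + 2 + 1 = i + 3 := by ring
  have e4 (i : ZMod n) : i + 3 + 1 = i + 4 := by ring
  have e5 (i : ZMod n) : i + 4 + 1 = i + 5 := by ring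
  unfold rpDrift
  simp only [cyclePot_eq_shift, ← Finset.sum_sub_distrib, Finset.mul_sum]
  simp only [Finset.sum_comm (s := (Finset.univ : Finset Bool))
    (t := (Finset.univ : Finset (ZMod n)))]
  rw [Finset.sum_comm]
  refine Finset.sum_congr rfl fun i _ => ?_
  rw [← Finset.sum_subset (Finset.subset_univ {i, i + 1, i + 2, i + 3, i + 4})]
  · rw [Finset.sum_insert, Finset.sum_insert, Finset.sum_insert, Finset.sum_insert,
      Finset.sum_singleton]
    · simp [windowDrift, setPair, add_assoc, h2, h3, h4, h12, h13, h14, h23, h24, h34, h15, h25, h35, h45,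
        h12.symm, h13.symm, h14.symm, h23.symm, h24.symm, h34.symm, e2, e3, e4, e5]
    all_goals simp [h1, h2, h3, h4, h12, h13, h14, h23, h24, h34]
  · intro j _ hj
    simp only [Finset.mem_insert, Finset.mem_singleton, not_or] at hj
    obtain ⟨j0, j1, j2, j3, j4⟩ := hj
    have k1 : i + 1 ≠ j + 1 := fun h => j0 (by linear_combination -h)
    have k2 : i + 2 ≠ j + 1 := fun h => j1 (by linear_combination -h)
    have k3 : i + 3 ≠ j + 1 := fun h => j2 (by linear_combination -h)
    have k4 : i + 4 ≠ j + 1 := fun h => j3 (by linear_combination -h)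
    simp only [setPair, Function.update_of_ne, ne_eq, k1, k2, k3, k4, Ne.symm j1, Ne.symm j2,
      Ne.symm j3, Ne.symm j4, not_false_eq_true, sub_self, mul_zero, Finset.sum_const_zero]

theorem rpDrift_cyclePot_le {p : ℝ} (hp : p ∈ Set.Icc (0.870 : ℝ) 1) {n : ℕ} [NeZero n]
    (hn : 5 ≤ n) (S : Config n) : rpDrift p cyclePot S ≤ -(cyclePot S / 100) := by
  have htele : ∑ i, windowCorr (S i) (S (i + 1)) (S (i + 2)) (S (i + 3)) (S (i + 4)) =
      ∑ i, windowCorr (S (i + 1)) (S (i + 2)) (S (i + 3)) (S (i + 4)) (S (i + 5)) := by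
    rw [← Equiv.sum_comp (Equiv.addRight (1 : ZMod n))]
    refine Finset.sum_congr rfl fun i _ => ?_
    simp only [Equiv.coe_addRight, add_assoc]
    norm_num
  rw [rpDrift_cyclePot p hn]
  refine (Finset.sum_le_sum fun i _ => windowDrift_le hp _ _ _ _ _ _).trans_eq ?_
  rw [Finset.sum_sub_distrib, Finset.sum_sub_distrib, htele, ← Finset.sum_div,
    ← cyclePot_eq_shift]
  ring

/-- Potential for the `3`-cycle. -/
def trianglePot : Bool → Bool → Bool → ℝ
  | true, true, true => 0
  | true, true, false | true, false, true | false, true, true => 11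
  | true, false, false | false, true, false | false, false, true => 10
  | false, false, false => 12

/-- Potential for the `4`-cycle. -/
def squarePot : Bool → Bool → Bool → Bool → ℝ
  | true, true, true, true => 0
  | true, true, true, false | true, true, false, true
  | true, false, true, true | false, true, true, true => 101
  | true, true, false, false | true, false, false, true
  | false, false, true, true | false, true, true, false => 100
  | true, false, true, false | false, true, false, true => 131
  | true, false, false, false | false, true, false, false
  | false, false, true, false | false, false, false, true => 130
  | false, false, false, false => 131

theorem trianglePot_nonneg (a b c : Bool) : 0 ≤ trianglePot a b c := by
  cases a <;> cases b <;> cases c <;> norm_num [trianglePot]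

theorem trianglePot_le (a b c : Bool) : trianglePot a b c ≤ 12 := by
  cases a <;> cases b <;> cases c <;> norm_num [trianglePot]

theorem one_le_trianglePot {a b c : Bool} (h : ¬(a = true ∧ b = true ∧ c = true)) :
    1 ≤ trianglePot a b c := by
  cases a <;> cases b <;> cases c <;> first | exact absurd ⟨rfl, rfl, rfl⟩ h | norm_num [trianglePot]

theorem squarePot_nonneg (a b c d : Bool) : 0 ≤ squarePot a b c d := by
  cases a <;> cases b <;> cases c <;> cases d <;> norm_num [squarePot]

theorem squarePot_le (a b c d : Bool) : squarePot a b c d ≤ 131 := by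
  cases a <;> cases b <;> cases c <;> cases d <;> norm_num [squarePot]

theorem one_le_squarePot {a b c d : Bool} (h : ¬(a = true ∧ b = true ∧ c = true ∧ d = true)) :
    1 ≤ squarePot a b c d := by
  cases a <;> cases b <;> cases c <;> cases d <;>
    first | exact absurd ⟨rfl, rfl, rfl, rfl⟩ h | norm_num [squarePot]

theorem rpDrift_trianglePot_le {p : ℝ} (hp : p ∈ Set.Icc (0.870 : ℝ) 1) (S : Config 3) :
    rpDrift p (fun S : Config 3 => trianglePot (S 0) (S 1) (S 2)) S ≤
      -(trianglePot (S 0) (S 1) (S 2) / 100) := by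
  obtain ⟨h0, h1⟩ := hp
  norm_num at h0
  have hsum (f : ZMod 3 → ℝ) : ∑ i, f i = f 0 + f 1 + f 2 := Fin.sum_univ_three f
  have e2 : (1 + 1 : ZMod 3) = 2 := rfl
  have e3 : (2 + 1 : ZMod 3) = 0 := rfl
  have d01 : (0 : ZMod 3) ≠ 1 := by decide
  have d02 : (0 : ZMod 3) ≠ 2 := by decide
  have d12 : (1 : ZMod 3) ≠ 2 := by decide
  unfold rpDrift
  rw [hsum]
  generalize hx : S 0 = x
  generalize hy : S 1 = y
  generalize hz : S 2 = z
  simp only [setPair, Function.update_apply, zero_add, e2, e3, d01, d02, d12, d01.symm, d02.symm,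
    d12.symm, hx, hy, hz, if_true, if_false]
  cases x <;> cases y <;> cases z <;> simp [pairProb, trianglePot] <;> nlinarith

theorem rpDrift_squarePot_le {p : ℝ} (hp : p ∈ Set.Icc (0.870 : ℝ) 1) (S : Config 4) :
    rpDrift p (fun S : Config 4 => squarePot (S 0) (S 1) (S 2) (S 3)) S ≤
      -(squarePot (S 0) (S 1) (S 2) (S 3) / 100) := by
  obtain ⟨h0, h1⟩ := hp
  norm_num at h0
  have hsum (f : ZMod 4 → ℝ) : ∑ i, f i = f 0 + f 1 + f 2 + f 3 := Fin.sum_univ_four f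
  have e2 : (1 + 1 : ZMod 4) = 2 := rfl
  have e3 : (2 + 1 : ZMod 4) = 3 := rfl
  have e4 : (3 + 1 : ZMod 4) = 0 := rfl
  have d01 : (0 : ZMod 4) ≠ 1 := by decide
  have d02 : (0 : ZMod 4) ≠ 2 := by decide
  have d03 : (0 : ZMod 4) ≠ 3 := by decide
  have d12 : (1 : ZMod 4) ≠ 2 := by decide
  have d13 : (1 : ZMod 4) ≠ 3 := by decide
  have d23 : (2 : ZMod 4) ≠ 3 := by decide
  unfold rpDrift
  rw [hsum]
  generalize hx : S 0 = x
  generalize hy : S 1 = y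
  generalize hz : S 2 = z
  generalize hw : S 3 = w
  simp only [setPair, Function.update_apply, zero_add, e2, e3, e4, d01, d02, d03, d12, d13, d23,
    d01.symm, d02.symm, d03.symm, d12.symm, d13.symm, d23.symm, hx, hy, hz, hw, if_true, if_false]
  cases x <;> cases y <;> cases z <;> cases w <;> simp [pairProb, squarePot] <;> nlinarith

/-- **Fast convergence of Rational Pavlov on the cycle.**
For every `p ∈ [0.870, 1]` there is a constant `ω > 0` such that for every `n ≥ 3`,
every initial configuration `S0` and every `ε ∈ (0,1)`: after any number
`t ≥ (n/ω)·log(n/ε)` of steps, the probability that the configuration is not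
the all-cooperate configuration is at most `ε`. -/
theorem rp_fast_convergence (p : ℝ) (hp : p ∈ Set.Icc (0.870 : ℝ) 1) :
    ∃ ω : ℝ, 0 < ω ∧
      ∀ (n : ℕ) [NeZero n], 3 ≤ n → ∀ S0 : Config n, ∀ ε : ℝ, ε ∈ Set.Ioo (0 : ℝ) 1 →
        ∀ t : ℕ, ((n : ℝ) / ω) * Real.log ((n : ℝ) / ε) ≤ (t : ℝ) →
          rpTrajProb p S0 t (fun σ => σ (Fin.last t) ≠ fun _ => true) ≤ ε := by
  have h0 : 0 ≤ p := le_trans (by norm_num) hp.1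
  have h1 : p ≤ 1 := hp.2
  refine ⟨1 / 400, by norm_num, fun n _ hn S₀ ε hε t ht => ?_⟩
  obtain rfl | rfl | hn5 : n = 3 ∨ n = 4 ∨ 5 ≤ n := by omega
  · refine rpTrajProb_le_of_rpDrift_le h0 h1 (by norm_num)
      (Φ := fun S => trianglePot (S 0) (S 1) (S 2)) (fun S => trianglePot_nonneg _ _ _)
      (fun S hS => one_le_trianglePot fun h => hS ?_)
      (fun S => (trianglePot_le _ _ _).trans (by norm_num)) ?_ S₀ hε ht
    · funext j
      obtain rfl | rfl | rfl : j = 0 ∨ j = 1 ∨ j = 2 := by revert j; decide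
      exacts [h.1, h.2.1, h.2.2]
    · convert rpDrift_trianglePot_le hp
  · refine rpTrajProb_le_of_rpDrift_le h0 h1 (by norm_num)
      (Φ := fun S => squarePot (S 0) (S 1) (S 2) (S 3)) (fun S => squarePot_nonneg _ _ _ _)
      (fun S hS => one_le_squarePot fun h => hS ?_)
      (fun S => (squarePot_le _ _ _ _).trans (by norm_num)) ?_ S₀ hε ht
    · funext j
      obtain rfl | rfl | rfl | rfl : j = 0 ∨ j = 1 ∨ j = 2 ∨ j = 3 := by revert j; decide
      exacts [h.1, h.2.1, h.2.2.1, h.2.2.2]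
    · convert rpDrift_squarePot_le hp
  · exact rpTrajProb_le_of_rpDrift_le h0 h1 (by omega) cyclePot_nonneg
      (fun S hS => one_le_cyclePot hS) (cyclePot_le hn5) (rpDrift_cyclePot_le hp hn5) S₀ hε ht
end

section
/- Lemma (no long cooperator runs in polynomial time). There exist constants p₁ > 0 and c > 0 such that for every p ∈ (0, p₁] and every sufficiently large n (in particular n ≥ e^{1/p}): if the RP chain is started from the all-defect configuration, then the probability that for some t ≤ e^{c·n} the configuration S_t contains at least ⌈n/4⌉ cyclically consecutive vertices in state true is at most e^{−c·n}. -/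
open scoped Classical

namespace RationalPavlov

open Finset

variable {n : ℕ}

/-- Forward distance from `a` to the next element of `D` on the cycle. -/
noncomputable def gap (D : Finset (ZMod n)) (a : ZMod n) : ℕ :=
  sInf {k : ℕ | 0 < k ∧ a + k ∈ D}

lemma gap_mem [NeZero n] {D : Finset (ZMod n)} {a : ZMod n} (ha : a ∈ D) :
    0 < gap D a ∧ a + gap D a ∈ D :=
  Nat.sInf_mem (s := {k : ℕ | 0 < k ∧ a + k ∈ D}) ⟨n, NeZero.pos n, by simpa using ha⟩

lemma add_notMem_of_lt_gap {D : Finset (ZMod n)} {a : ZMod n} {j : ℕ}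
    (h0 : 0 < j) (hj : j < gap D a) : a + j ∉ D :=
  fun h => Nat.notMem_of_lt_sInf (s := {k : ℕ | 0 < k ∧ a + k ∈ D}) hj ⟨h0, h⟩

lemma gap_eq {D : Finset (ZMod n)} {a : ZMod n} {k : ℕ} (h0 : 0 < k) (hk : a + k ∈ D)
    (h : ∀ j : ℕ, 0 < j → j < k → a + j ∉ D) : gap D a = k := by
  refine le_antisymm (Nat.sInf_le ⟨h0, hk⟩) (le_csInf ⟨k, h0, hk⟩ ?_)
  rintro j ⟨hj0, hj⟩
  by_contra! hlt
  exact h j hj0 hlt hj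

lemma lt_gap [NeZero n] {D : Finset (ZMod n)} {a : ZMod n} (ha : a ∈ D) {m : ℕ}
    (h : ∀ j : ℕ, 0 < j → j ≤ m → a + j ∉ D) : m < gap D a := by
  by_contra! hle
  exact h _ (gap_mem ha).1 hle (gap_mem ha).2

lemma gap_le [NeZero n] {D : Finset (ZMod n)} {a : ZMod n} (ha : a ∈ D) : gap D a ≤ n :=
  Nat.sInf_le ⟨NeZero.pos n, by simpa using ha⟩

lemma exists_add_eq_of_notMem [NeZero n] {D : Finset (ZMod n)} (hD : D.Nonempty) {x : ZMod n}
    (hx : x ∉ D) : ∃ a ∈ D, ∃ j : ℕ, 0 < j ∧ j < gap D a ∧ a + j = x := by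
  obtain ⟨d, hd⟩ := hD
  have hex : ∃ j : ℕ, x - j ∈ D := ⟨(x - d).val, by simpa using hd⟩
  have hmem := Nat.find_spec hex
  have hmin : ∀ i < Nat.find hex, x - (i : ZMod n) ∉ D := fun i hi => Nat.find_min hex hi
  set j := Nat.find hex
  refine ⟨x - j, hmem, j, ?_, ?_, by ring⟩
  · rcases Nat.eq_zero_or_pos j with h | h
    · rw [h] at hmem; simp [hx] at hmem
    · exact h
  · refine lt_gap hmem fun i hi0 hij hi => hmin (j - i) (by omega) ?_
    rw [Nat.cast_sub hij]
    convert hi using 1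
    ring

section Insert

variable {D : Finset (ZMod n)} {a : ZMod n} {j : ℕ}

lemma gap_insert_left (ha : a ∈ D) (h0 : 0 < j) (hj : j < gap D a) :
    gap (insert (a + (j : ZMod n)) D) a = j := by
  refine gap_eq h0 (by simp) fun i hi0 hij hi => ?_
  rcases mem_insert.1 hi with h | h
  · have hji : a + ((j - i : ℕ) : ZMod n) = a := by
      rw [Nat.cast_sub hij.le, ← add_left_cancel h]; ring
    exact add_notMem_of_lt_gap (D := D) (a := a) (j := j - i) (by omega) (by omega)
      (by rwa [hji])
  · exact add_notMem_of_lt_gap hi0 (hij.trans hj) h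

lemma gap_insert_self [NeZero n] (ha : a ∈ D) (h0 : 0 < j) (hj : j < gap D a) :
    gap (insert (a + (j : ZMod n)) D) (a + j) = gap D a - j := by
  have key : ∀ i : ℕ, a + (j : ZMod n) + i = a + ((j + i : ℕ) : ZMod n) := fun i => by
    push_cast; ring
  refine gap_eq (by omega) ?_ fun i hi0 hi h => ?_
  · rw [key, Nat.add_sub_cancel' hj.le]
    exact mem_insert_of_mem (gap_mem ha).2
  · rcases mem_insert.1 h with h | h
    · have hi' : (i : ZMod n) = 0 := by simpa using h
      exact add_notMem_of_lt_gap (D := D) (a := a) (j := i) hi0 (by omega) (by simpa [hi'])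
    · rw [key] at h
      exact add_notMem_of_lt_gap (by omega) (by omega) h

lemma gap_insert_of_ne [NeZero n] (ha : a ∈ D) (h0 : 0 < j) (hj : j < gap D a) {b : ZMod n}
    (hb : b ∈ D) (hab : b ≠ a) :
    gap (insert (a + (j : ZMod n)) D) b = gap D b := by
  refine gap_eq (gap_mem hb).1 (mem_insert_of_mem (gap_mem hb).2) fun i hi0 hi h => ?_
  rcases mem_insert.1 h with h | h
  · rcases lt_trichotomy i j with hij | rfl | hij
    · refine add_notMem_of_lt_gap (D := D) (a := a) (j := j - i) (by omega) (by omega) ?_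
      have : a + ((j - i : ℕ) : ZMod n) = b := by
        rw [Nat.cast_sub hij.le]; linear_combination -h
      rwa [this]
    · exact hab (add_right_cancel h)
    · refine add_notMem_of_lt_gap (D := D) (a := b) (j := i - j) (by omega) (by omega) ?_
      have : b + ((i - j : ℕ) : ZMod n) = a := by
        rw [Nat.cast_sub hij.le]; linear_combination h
      rwa [this]
  · exact add_notMem_of_lt_gap hi0 hi h

end Insert

/-- Weight of a set of defectors: a defective renewal weight with gap law proportional to
`(1/16)^(k-1) / k^2`. -/
noncomputable def weight [NeZero n] (D : Finset (ZMod n)) : ℝ :=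
  (1 / 16) ^ (Dᶜ).card * ∏ a ∈ D, ((gap D a : ℝ) ^ 2)⁻¹

lemma weight_nonneg [NeZero n] (D : Finset (ZMod n)) : 0 ≤ weight D := by
  unfold weight; positivity

lemma weight_le [NeZero n] (D : Finset (ZMod n)) : weight D ≤ (1 / 16) ^ (Dᶜ).card := by
  unfold weight
  refine mul_le_of_le_one_right (by positivity) (prod_le_one (fun _ _ => by positivity) ?_)
  intro a ha
  refine inv_le_one_of_one_le₀ (one_le_pow₀ ?_)
  exact_mod_cast (gap_mem ha).1

lemma weight_univ [NeZero n] : weight (univ : Finset (ZMod n)) = 1 := by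
  have : ∀ a : ZMod n, gap univ a = 1 := fun a =>
    gap_eq one_pos (mem_univ _) (fun j _ _ => by omega)
  simp [weight, this]

lemma weight_insert [NeZero n] {D : Finset (ZMod n)} {a : ZMod n} {j : ℕ} (ha : a ∈ D)
    (h0 : 0 < j) (hj : j < gap D a) :
    weight (insert (a + (j : ZMod n)) D) =
      16 * weight D * ((gap D a : ℝ) ^ 2 / ((j : ℝ) ^ 2 * ((gap D a - j : ℕ) : ℝ) ^ 2)) := by
  have hx : a + (j : ZMod n) ∉ D := add_notMem_of_lt_gap h0 hj
  have hcard : (Dᶜ).card = ((insert (a + (j : ZMod n)) D)ᶜ).card + 1 := by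
    have h1 := card_add_card_compl D
    have h2 := card_add_card_compl (insert (a + (j : ZMod n)) D)
    rw [card_insert_of_notMem hx] at h2
    omega
  have hg : (gap D a : ℝ) ≠ 0 := by exact_mod_cast (h0.trans hj).ne'
  have hprod : ∏ b ∈ D.erase a, ((gap (insert (a + (j : ZMod n)) D) b : ℝ) ^ 2)⁻¹ =
      ∏ b ∈ D.erase a, ((gap D b : ℝ) ^ 2)⁻¹ :=
    prod_congr rfl fun b hb => by
      rw [gap_insert_of_ne ha h0 hj (mem_of_mem_erase hb) (ne_of_mem_erase hb)]
  unfold weight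
  rw [prod_insert hx, ← mul_prod_erase D _ ha, ← mul_prod_erase D _ ha, hprod,
    gap_insert_left ha h0 hj, gap_insert_self ha h0 hj, hcard]
  generalize ∏ b ∈ D.erase a, ((gap D b : ℝ) ^ 2)⁻¹ = P
  field_simp
  ring

lemma weight_le_insert_succ [NeZero n] {D : Finset (ZMod n)} {a : ZMod n} (ha : a ∈ D)
    (h : a + 1 ∉ D) : weight D ≤ 1 / 16 * weight (insert (a + 1) D) := by
  have hj : 1 < gap D a := lt_gap ha fun j h0 h1 => by
    obtain rfl : j = 1 := by omega
    simpa using h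
  have := weight_insert ha one_pos hj
  rw [Nat.cast_one] at this
  rw [this]
  have h2 : 1 ≤ (gap D a : ℝ) ^ 2 / (((1 : ℕ) : ℝ) ^ 2 * ((gap D a - 1 : ℕ) : ℝ) ^ 2) := by
    have : (0 : ℝ) < ((gap D a - 1 : ℕ) : ℝ) := by exact_mod_cast (by omega : 0 < gap D a - 1)
    rw [le_div_iff₀ (by positivity)]
    have : ((gap D a - 1 : ℕ) : ℝ) ≤ gap D a := by exact_mod_cast Nat.sub_le _ _
    simp only [Nat.cast_one, one_pow, one_mul]
    gcongr
  nlinarith [weight_nonneg D]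

lemma weight_insert_succ_le [NeZero n] {D : Finset (ZMod n)} {a : ZMod n} (ha : a ∈ D)
    (h : a + 1 ∉ D) : weight (insert (a + 1) D) ≤ 64 * weight D := by
  have hj : 1 < gap D a := lt_gap ha fun j h0 h1 => by
    obtain rfl : j = 1 := by omega
    simpa using h
  have := weight_insert ha one_pos hj
  rw [Nat.cast_one] at this
  rw [this]
  have h2 : (gap D a : ℝ) ^ 2 / (((1 : ℕ) : ℝ) ^ 2 * ((gap D a - 1 : ℕ) : ℝ) ^ 2) ≤ 4 := by
    have h0 : (0 : ℝ) < ((gap D a - 1 : ℕ) : ℝ) := by exact_mod_cast (by omega : 0 < gap D a - 1)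
    rw [div_le_iff₀ (by positivity)]
    have : (gap D a : ℝ) ≤ 2 * ((gap D a - 1 : ℕ) : ℝ) := by
      exact_mod_cast (by omega : gap D a ≤ 2 * (gap D a - 1))
    simp only [Nat.cast_one, one_pow, one_mul]
    calc (gap D a : ℝ) ^ 2 ≤ (2 * ((gap D a - 1 : ℕ) : ℝ)) ^ 2 := by gcongr
      _ = _ := by ring
  nlinarith [weight_nonneg D]

lemma sum_inv_sq_le (N : ℕ) : ∑ j ∈ Ico 1 N, ((j : ℝ) ^ 2)⁻¹ ≤ 2 := by
  have h : ∀ M : ℕ, ∑ j ∈ Ico 1 (M + 2), ((j : ℝ) ^ 2)⁻¹ ≤ 2 - 1 / (M + 1) := by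
    intro M
    induction M with
    | zero => norm_num
    | succ M ih =>
      rw [sum_Ico_succ_top (by omega)]
      have : (((M + 2 : ℕ) : ℝ) ^ 2)⁻¹ ≤ 1 / (M + 1 : ℝ) - 1 / ((M + 1 : ℕ) + 1 : ℝ) := by
        push_cast
        rw [div_sub_div _ _ (by positivity) (by positivity), inv_eq_one_div,
          div_le_div_iff₀ (by positivity) (by positivity)]
        nlinarith [(Nat.cast_nonneg M : (0 : ℝ) ≤ M)]
      linarith
  rcases N with _ | _ | N
  · simp
  · simp
  · have : (0 : ℝ) ≤ 1 / (N + 1) := by positivity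
    linarith [h N]

lemma sum_gap_ratio_le (k : ℕ) :
    ∑ j ∈ Ico 1 k, (k : ℝ) ^ 2 / ((j : ℝ) ^ 2 * ((k - j : ℕ) : ℝ) ^ 2) ≤ 8 := by
  have hterm : ∀ j ∈ Ico 1 k, (k : ℝ) ^ 2 / ((j : ℝ) ^ 2 * ((k - j : ℕ) : ℝ) ^ 2) ≤
      2 * ((j : ℝ) ^ 2)⁻¹ + 2 * (((k - j : ℕ) : ℝ) ^ 2)⁻¹ := by
    intro j hj
    obtain ⟨h1, h2⟩ := mem_Ico.1 hj
    have hk : (k : ℝ) = j + ((k - j : ℕ) : ℝ) := by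
      rw [Nat.cast_sub h2.le]; ring
    have hj0 : (0 : ℝ) < j := by exact_mod_cast h1
    have hr0 : (0 : ℝ) < ((k - j : ℕ) : ℝ) := by exact_mod_cast (by omega : 0 < k - j)
    rw [hk]
    generalize ((k - j : ℕ) : ℝ) = r at *
    rw [div_le_iff₀ (by positivity)]
    have : (2 * ((j : ℝ) ^ 2)⁻¹ + 2 * (r ^ 2)⁻¹) * ((j : ℝ) ^ 2 * r ^ 2) =
        2 * r ^ 2 + 2 * (j : ℝ) ^ 2 := by field_simp
    rw [this]
    nlinarith [sq_nonneg ((j : ℝ) - r)]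
  refine (sum_le_sum hterm).trans ?_
  rw [sum_add_distrib, ← mul_sum, ← mul_sum]
  have hrefl : ∑ j ∈ Ico 1 k, (((k - j : ℕ) : ℝ) ^ 2)⁻¹ = ∑ j ∈ Ico 1 k, ((j : ℝ) ^ 2)⁻¹ := by
    refine sum_nbij' (fun j => k - j) (fun j => k - j) ?_ ?_ ?_ ?_ ?_ <;>
      simp only [mem_Ico, implies_true] <;> intros <;> omega
  rw [hrefl]
  linarith [sum_inv_sq_le k]

/-- Sum of the weights of the sets disjoint from `A`; it dominates the probability that all of `A`
cooperates. -/
noncomputable def avoidWeight [NeZero n] (A : Finset (ZMod n)) : ℝ := ∑ D ∈ Aᶜ.powerset, weight D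

lemma avoidWeight_nonneg [NeZero n] (A : Finset (ZMod n)) : 0 ≤ avoidWeight A :=
  sum_nonneg fun D _ => weight_nonneg D

lemma avoidWeight_anti [NeZero n] {A B : Finset (ZMod n)} (h : A ⊆ B) :
    avoidWeight B ≤ avoidWeight A :=
  sum_le_sum_of_subset_of_nonneg (powerset_mono.2 (compl_subset_compl.2 h))
    fun D _ _ => weight_nonneg D

lemma one_le_avoidWeight_empty [NeZero n] : 1 ≤ avoidWeight (∅ : Finset (ZMod n)) := by
  rw [← weight_univ (n := n)]
  exact single_le_sum (f := weight) (fun D _ => weight_nonneg D) (by simp)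

lemma avoidWeight_le [NeZero n] (A : Finset (ZMod n)) :
    avoidWeight A ≤ (1 / 16) ^ A.card * (17 / 16) ^ (Aᶜ).card := by
  have h := sum_pow_mul_eq_add_pow (1 : ℝ) (1 / 16) Aᶜ
  calc avoidWeight A ≤ ∑ D ∈ Aᶜ.powerset,
        (1 / 16 : ℝ) ^ A.card * (1 ^ D.card * (1 / 16) ^ ((Aᶜ).card - D.card)) := by
        refine sum_le_sum fun D hD => (weight_le D).trans_eq ?_
        have h1 := card_le_card (mem_powerset.1 hD)
        have h2 := card_add_card_compl A
        have h3 := card_add_card_compl D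
        rw [one_pow, one_mul, ← pow_add]
        congr 1
        omega
    _ = _ := by rw [← mul_sum, h]; norm_num

/-- The pairs of a set `D` avoiding `A` and a point `a ∈ D` such that `a + m` is the first element
of `A ∪ D` met when going forward from `a`, and it belongs to `A`. -/
noncomputable def firstHits [NeZero n] (A : Finset (ZMod n)) (m : ℕ) :
    Finset (Finset (ZMod n) × ZMod n) :=
  {q | q.1 ⊆ Aᶜ ∧ q.2 ∈ q.1 ∧ q.2 + (m : ZMod n) ∈ A ∧
    ∀ i : ℕ, 0 < i → i < m → q.2 + (i : ZMod n) ∉ q.1 ∧ q.2 + (i : ZMod n) ∉ A}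

lemma mem_firstHits [NeZero n] {A : Finset (ZMod n)} {m : ℕ} {q : Finset (ZMod n) × ZMod n} :
    q ∈ firstHits A m ↔ q.1 ⊆ Aᶜ ∧ q.2 ∈ q.1 ∧ q.2 + (m : ZMod n) ∈ A ∧
      ∀ i : ℕ, 0 < i → i < m → q.2 + (i : ZMod n) ∉ q.1 ∧ q.2 + (i : ZMod n) ∉ A := by
  simp [firstHits]

/-- Total weight of the pairs in `firstHits A m`. -/
noncomputable def firstHitWeight [NeZero n] (A : Finset (ZMod n)) (m : ℕ) : ℝ :=
  ∑ q ∈ firstHits A m, weight q.1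

lemma firstHitWeight_nonneg [NeZero n] (A : Finset (ZMod n)) (m : ℕ) : 0 ≤ firstHitWeight A m :=
  sum_nonneg fun q _ => weight_nonneg q.1

lemma sum_comp_le_sum_of_injOn {ι κ : Type*} {s : Finset ι} {u : Finset κ} {φ : ι → κ} {f : κ → ℝ}
    (hinj : Set.InjOn φ s) (hmaps : ∀ q ∈ s, φ q ∈ u) (hf : ∀ r, 0 ≤ f r) :
    ∑ q ∈ s, f (φ q) ≤ ∑ r ∈ u, f r := by
  rw [← sum_image hinj]
  exact sum_le_sum_of_subset_of_nonneg (image_subset_iff.2 hmaps) fun r _ _ => hf r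

lemma add_one_notMem_of_mem_firstHits [NeZero n] {A : Finset (ZMod n)} {m : ℕ} (hm : 0 < m)
    {q : Finset (ZMod n) × ZMod n} (hq : q ∈ firstHits A (m + 1)) : q.2 + 1 ∉ q.1 ∧ q.2 + 1 ∉ A := by
  simpa using (mem_firstHits.1 hq).2.2.2 1 one_pos (by omega)

lemma injOn_insert_succ_firstHits [NeZero n] (A : Finset (ZMod n)) {m : ℕ} (hm : 0 < m) :
    Set.InjOn (fun q : Finset (ZMod n) × ZMod n => (insert (q.2 + 1) q.1, q.2 + 1))
      (firstHits A (m + 1)) := by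
  rintro ⟨D, a⟩ hq ⟨D', a'⟩ hq' h
  obtain ⟨h1, h2⟩ := Prod.mk.inj h
  obtain rfl : a = a' := add_right_cancel h2
  have := congrArg (fun E => erase E (a + 1)) h1
  simp only [erase_insert (add_one_notMem_of_mem_firstHits hm hq).1,
    erase_insert (add_one_notMem_of_mem_firstHits hm hq').1] at this
  rw [this]

lemma insert_succ_mem_firstHits [NeZero n] {A : Finset (ZMod n)} {m : ℕ} (hm : 0 < m) (hmn : m < n)
    {q : Finset (ZMod n) × ZMod n} (hq : q ∈ firstHits A (m + 1)) :
    (insert (q.2 + 1) q.1, q.2 + 1) ∈ firstHits A m := by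
  have hnot := add_one_notMem_of_mem_firstHits hm hq
  obtain ⟨D, a⟩ := q
  obtain ⟨h1, h2, h3, h4⟩ := mem_firstHits.1 hq
  dsimp only at h1 h2 h3 h4 hnot ⊢
  have hcast : ∀ i : ℕ, a + 1 + (i : ZMod n) = a + ((i + 1 : ℕ) : ZMod n) := fun i => by
    push_cast; ring
  rw [mem_firstHits]
  dsimp only
  refine ⟨insert_subset (mem_compl.2 hnot.2) h1, mem_insert_self _ _, by rwa [hcast],
    fun i hi0 him => ?_⟩
  have h5 := h4 (i + 1) (by omega) (by omega)
  rw [← hcast] at h5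
  refine ⟨fun h => ?_, h5.2⟩
  rcases mem_insert.1 h with h | h
  · have h0 : (i : ZMod n) = 0 := by simpa using h
    rw [ZMod.natCast_eq_zero_iff] at h0
    exact absurd (Nat.le_of_dvd hi0 h0) (by omega)
  · exact h5.1 h

lemma firstHitWeight_succ_le [NeZero n] (A : Finset (ZMod n)) {m : ℕ} (hm : 0 < m) (hmn : m < n) :
    firstHitWeight A (m + 1) ≤ 1 / 16 * firstHitWeight A m := by
  unfold firstHitWeight
  rw [mul_sum]
  have hle : ∀ q ∈ firstHits A (m + 1), weight q.1 ≤ 1 / 16 * weight (insert (q.2 + 1) q.1) :=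
    fun _ hq => weight_le_insert_succ (mem_firstHits.1 hq).2.1
      (add_one_notMem_of_mem_firstHits hm hq).1
  have hmaps : ∀ q ∈ firstHits A (m + 1),
      (fun q : Finset (ZMod n) × ZMod n => (insert (q.2 + 1) q.1, q.2 + 1)) q ∈ firstHits A m :=
    fun _ hq => insert_succ_mem_firstHits hm hmn hq
  have hnonneg : ∀ r : Finset (ZMod n) × ZMod n,
      0 ≤ (fun r : Finset (ZMod n) × ZMod n => 1 / 16 * weight r.1) r :=
    fun r => mul_nonneg (one_div_nonneg.2 (Nat.ofNat_nonneg 16)) (weight_nonneg r.1)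
  have hcomp := sum_comp_le_sum_of_injOn (injOn_insert_succ_firstHits A hm) hmaps hnonneg
  exact (sum_le_sum hle).trans hcomp

lemma firstHitWeight_le [NeZero n] (A : Finset (ZMod n)) :
    ∀ m : ℕ, m < n → firstHitWeight A (m + 1) ≤ (1 / 16) ^ m * firstHitWeight A 1
  | 0, _ => by simp
  | m + 1, hm => by
    have h1 := firstHitWeight_succ_le A (m := m + 1) (by omega) hm
    have h2 := firstHitWeight_le A m (by omega)
    rw [pow_succ]
    linarith

lemma sum_firstHitWeight_le [NeZero n] (A : Finset (ZMod n)) :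
    ∑ m ∈ range n, firstHitWeight A (m + 1) ≤ 16 / 15 * firstHitWeight A 1 := by
  calc ∑ m ∈ range n, firstHitWeight A (m + 1)
      ≤ ∑ m ∈ range n, (1 / 16 : ℝ) ^ m * firstHitWeight A 1 :=
        sum_le_sum fun m hm => firstHitWeight_le A m (mem_range.1 hm)
    _ = (∑ m ∈ range n, (1 / 16 : ℝ) ^ m) * firstHitWeight A 1 := (sum_mul ..).symm
    _ ≤ 16 / 15 * firstHitWeight A 1 := by
        refine mul_le_mul_of_nonneg_right ?_ (firstHitWeight_nonneg A 1)
        rw [geom_sum_eq (by norm_num), div_le_iff_of_neg (by norm_num)]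
        have : (0 : ℝ) ≤ (1 / 16) ^ n := by positivity
        linarith

lemma sum_weight_insert_le [NeZero n] {A D : Finset (ZMod n)} (hD : D.Nonempty)
    (hDA : D ⊆ Aᶜ) :
    ∑ x ∈ A, weight (insert x D) ≤
      128 * ∑ a ∈ D with ∃ j : ℕ, 0 < j ∧ j < gap D a ∧ a + j ∈ A, weight D := by
  have hpos : ∀ a j, 0 ≤ weight (insert (a + ((j : ℕ) : ZMod n)) D) := fun a j => weight_nonneg _
  calc ∑ x ∈ A, weight (insert x D)
      ≤ ∑ x ∈ A, ∑ a ∈ D, ∑ j ∈ Ico 1 (gap D a),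
          if a + (j : ZMod n) = x then weight (insert (a + (j : ZMod n)) D) else 0 := by
        refine sum_le_sum fun x hx => ?_
        obtain ⟨a, ha, j, h0, hj, rfl⟩ :=
          exists_add_eq_of_notMem hD (x := x) fun h => by simpa [hx] using hDA h
        refine le_trans ?_ (single_le_sum (fun b _ => sum_nonneg fun i _ => ?_) ha)
        · refine le_trans ?_ (single_le_sum (fun i _ => ?_) (mem_Ico.2 ⟨h0, hj⟩))
          · simp
          · split_ifs <;> simp [hpos]
        · split_ifs <;> simp [hpos]
    _ = ∑ a ∈ D, ∑ j ∈ Ico 1 (gap D a),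
          if a + (j : ZMod n) ∈ A then weight (insert (a + (j : ZMod n)) D) else 0 := by
        rw [sum_comm]
        refine sum_congr rfl fun a _ => ?_
        rw [sum_comm]
        refine sum_congr rfl fun j _ => ?_
        rw [sum_ite_eq]
    _ ≤ ∑ a ∈ D, if ∃ j : ℕ, 0 < j ∧ j < gap D a ∧ a + j ∈ A then 128 * weight D else 0 := by
        refine sum_le_sum fun a ha => ?_
        split_ifs with h
        · calc _ ≤ ∑ j ∈ Ico 1 (gap D a), 16 * weight D *
                ((gap D a : ℝ) ^ 2 / ((j : ℝ) ^ 2 * ((gap D a - j : ℕ) : ℝ) ^ 2)) := by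
                refine sum_le_sum fun j hj => ?_
                rw [← weight_insert ha (mem_Ico.1 hj).1 (mem_Ico.1 hj).2]
                split_ifs <;> simp [hpos]
            _ ≤ 128 * weight D := by
                rw [← mul_sum]
                nlinarith [sum_gap_ratio_le (gap D a), weight_nonneg D]
        · refine (sum_eq_zero fun j hj => if_neg fun hA => h ⟨j, ?_⟩).le
          exact ⟨(mem_Ico.1 hj).1, (mem_Ico.1 hj).2, hA⟩
    _ = _ := by rw [sum_filter, mul_sum]; simp only [mul_ite, mul_zero]

lemma sum_sum_weight_hit_le [NeZero n] (A : Finset (ZMod n)) :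
    ∑ D ∈ Aᶜ.powerset, ∑ a ∈ D with ∃ j : ℕ, 0 < j ∧ j < gap D a ∧ a + j ∈ A, weight D ≤
      ∑ m ∈ range n, firstHitWeight A (m + 1) := by
  have hterm : ∀ D ∈ Aᶜ.powerset, ∀ a ∈ D,
      (if ∃ j : ℕ, 0 < j ∧ j < gap D a ∧ a + j ∈ A then weight D else 0) ≤
        ∑ m ∈ range n, if a + ((m + 1 : ℕ) : ZMod n) ∈ A ∧
          ∀ i : ℕ, 0 < i → i < m + 1 → a + i ∉ D ∧ a + i ∉ A then weight D else 0 := by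
    intro D _ a ha
    have hnn : ∀ m ∈ range n, 0 ≤ if a + ((m + 1 : ℕ) : ZMod n) ∈ A ∧
          ∀ i : ℕ, 0 < i → i < m + 1 → a + i ∉ D ∧ a + i ∉ A then weight D else 0 :=
      fun m _ => by split_ifs <;> simp [weight_nonneg]
    split_ifs with h
    · have hs := Nat.find_spec h
      have hmin : ∀ i < Nat.find h, ¬ _ := fun i hi => Nat.find_min h hi
      set j := Nat.find h
      have hle := gap_le ha
      refine le_trans ?_ (single_le_sum hnn (mem_range.2 (by omega : j - 1 < n)))
      rw [Nat.sub_add_cancel hs.1, if_pos]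
      exact ⟨hs.2.2, fun i hi0 hij => ⟨add_notMem_of_lt_gap hi0 (hij.trans hs.2.1),
        fun hA => hmin i hij ⟨hi0, hij.trans hs.2.1, hA⟩⟩⟩
    · exact sum_nonneg hnn
  calc _ ≤ ∑ D ∈ Aᶜ.powerset, ∑ a ∈ D, ∑ m ∈ range n,
        if a + ((m + 1 : ℕ) : ZMod n) ∈ A ∧
          ∀ i : ℕ, 0 < i → i < m + 1 → a + i ∉ D ∧ a + i ∉ A then weight D else 0 := by
        refine sum_le_sum fun D hD => ?_
        rw [sum_filter]
        exact sum_le_sum (hterm D hD)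
    _ = ∑ m ∈ range n, firstHitWeight A (m + 1) := by
        rw [sum_congr rfl fun D _ => sum_comm, sum_comm]
        refine sum_congr rfl fun m _ => ?_
        simp_rw [← sum_filter]
        refine (sum_finset_product' _ _ _ fun q => ?_).symm
        simp only [mem_firstHits, mem_filter, mem_powerset]

/-- Weight of the sets of defectors meeting `A` exactly in `x`. -/
noncomputable def pinnedWeight [NeZero n] (A : Finset (ZMod n)) (x : ZMod n) : ℝ :=
  if x ∈ A then ∑ D ∈ Aᶜ.powerset, weight (insert x D) else 0

lemma pinnedWeight_nonneg [NeZero n] (A : Finset (ZMod n)) (x : ZMod n) :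
    0 ≤ pinnedWeight A x := by
  unfold pinnedWeight
  split_ifs
  · exact sum_nonneg fun D _ => weight_nonneg _
  · rfl

lemma sum_pinnedWeight_le [NeZero n] (A : Finset (ZMod n)) :
    ∑ x, pinnedWeight A x ≤ n * (1 / 16) ^ (n - 1) + 137 * firstHitWeight A 1 := by
  have hempty : ∑ x ∈ A, weight (insert x ∅) ≤ n * (1 / 16) ^ (n - 1) := by
    calc ∑ x ∈ A, weight (insert x ∅) ≤ ∑ x ∈ A, (1 / 16 : ℝ) ^ (n - 1) :=
          sum_le_sum fun x _ => (weight_le _).trans_eq (by simp [card_compl, ZMod.card])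
      _ ≤ n * (1 / 16) ^ (n - 1) := by
          rw [sum_const, nsmul_eq_mul]
          gcongr
          simpa [ZMod.card] using card_le_univ A
  calc ∑ x, pinnedWeight A x = ∑ D ∈ Aᶜ.powerset, ∑ x ∈ A, weight (insert x D) := by
        simp only [pinnedWeight]
        rw [← sum_filter, filter_mem_eq_inter, univ_inter, sum_comm]
    _ ≤ ∑ D ∈ Aᶜ.powerset, ((if D = ∅ then n * (1 / 16 : ℝ) ^ (n - 1) else 0) +
          128 * ∑ a ∈ D with ∃ j : ℕ, 0 < j ∧ j < gap D a ∧ a + j ∈ A, weight D) := by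
        refine sum_le_sum fun D hD => ?_
        rcases D.eq_empty_or_nonempty with rfl | hne
        · simpa using hempty
        · rw [if_neg hne.ne_empty, zero_add]
          exact sum_weight_insert_le hne (mem_powerset.1 hD)
    _ = n * (1 / 16) ^ (n - 1) + 128 * ∑ D ∈ Aᶜ.powerset,
          ∑ a ∈ D with ∃ j : ℕ, 0 < j ∧ j < gap D a ∧ a + j ∈ A, weight D := by
        rw [sum_add_distrib, ← mul_sum, sum_ite_eq', if_pos (empty_mem_powerset _)]
    _ ≤ _ := by
        linarith [sum_sum_weight_hit_le A, sum_firstHitWeight_le A, firstHitWeight_nonneg A 1]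

lemma avoidWeight_sdiff_singleton [NeZero n] {A : Finset (ZMod n)} {x : ZMod n} (hx : x ∈ A) :
    ∑ D ∈ (insert x Aᶜ).powerset, weight D = avoidWeight A + pinnedWeight A x := by
  rw [sum_powerset_insert (by simpa using hx), pinnedWeight, if_pos hx, avoidWeight]

/-- Edge-wise gain: freeing the sites of an edge meeting `A`. -/
lemma avoidWeight_sdiff_edge_le [NeZero n] (hn : 1 < n) {A : Finset (ZMod n)} {i : ZMod n}
    (h : i ∈ A ∨ i + 1 ∈ A) :
    avoidWeight (A \ {i, i + 1}) ≤
      avoidWeight A + (65 * pinnedWeight A i + pinnedWeight A (i + 1)) := by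
  have : Fact (1 < n) := ⟨hn⟩
  have hne : i + 1 ≠ i := by simp
  have h0 := pinnedWeight_nonneg A i
  have h1 := pinnedWeight_nonneg A (i + 1)
  by_cases hi : i ∈ A <;> by_cases hi' : i + 1 ∈ A
  · have hc : (A \ {i, i + 1})ᶜ = insert (i + 1) (insert i Aᶜ) := by
      ext x; simp only [mem_compl, mem_sdiff, mem_insert, mem_singleton]; tauto
    have hs : ∑ D ∈ (insert i Aᶜ).powerset, weight (insert (i + 1) D) ≤
        pinnedWeight A (i + 1) + 64 * pinnedWeight A i := by
      rw [sum_powerset_insert (by simpa using hi), pinnedWeight, if_pos hi', pinnedWeight,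
        if_pos hi, mul_sum]
      refine add_le_add_right (sum_le_sum fun D hD => ?_) _
      refine weight_insert_succ_le (mem_insert_self _ _) fun hmem => ?_
      rcases mem_insert.1 hmem with h | h
      · exact hne h
      · simpa [hi'] using mem_powerset.1 hD h
    have : avoidWeight (A \ {i, i + 1}) = ∑ D ∈ (insert i Aᶜ).powerset, weight D +
        ∑ D ∈ (insert i Aᶜ).powerset, weight (insert (i + 1) D) := by
      rw [avoidWeight, hc, sum_powerset_insert (by simp [hi', hne])]
    rw [avoidWeight_sdiff_singleton hi] at this
    linarith
  · have hc : (A \ {i, i + 1})ᶜ = insert i Aᶜ := by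
      ext x; simp only [mem_compl, mem_sdiff, mem_insert, mem_singleton]
      grind
    rw [avoidWeight, hc, avoidWeight_sdiff_singleton hi]
    linarith
  · have hc : (A \ {i, i + 1})ᶜ = insert (i + 1) Aᶜ := by
      ext x; simp only [mem_compl, mem_sdiff, mem_insert, mem_singleton]
      grind
    rw [avoidWeight, hc, avoidWeight_sdiff_singleton hi']
    linarith
  · tauto

lemma firstHitWeight_one_le [NeZero n] (A : Finset (ZMod n)) :
    firstHitWeight A 1 ≤ ∑ i : ZMod n, if i ∈ A ∨ i + 1 ∈ A then
      avoidWeight A - avoidWeight (A ∪ {i, i + 1}) else 0 := by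
  have heq : firstHitWeight A 1 =
      ∑ i : ZMod n, ∑ D ∈ Aᶜ.powerset with i ∈ D ∧ i + 1 ∈ A, weight D := by
    unfold firstHitWeight
    refine sum_finset_product_right (f := fun q => weight q.1) _ _ _ fun q => ?_
    simp only [mem_firstHits, mem_filter, mem_univ, true_and, mem_powerset, Nat.cast_one]
    constructor
    · tauto
    · exact fun h => ⟨h.1, h.2.1, h.2.2, fun i h1 h2 => by omega⟩
  rw [heq]
  refine sum_le_sum fun i _ => ?_
  by_cases hi : i + 1 ∈ A
  · rw [if_pos (Or.inr hi)]
    have hsplit := sum_filter_add_sum_filter_not Aᶜ.powerset (fun D => i ∈ D) weight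
    have hle : avoidWeight (A ∪ {i, i + 1}) ≤ ∑ D ∈ Aᶜ.powerset with i ∉ D, weight D := by
      refine sum_le_sum_of_subset_of_nonneg (fun D hD => ?_) fun D _ _ => weight_nonneg D
      have hD' := mem_powerset.1 hD
      refine mem_filter.2 ⟨mem_powerset.2 fun x hx => ?_, fun hiD => ?_⟩
      · have := hD' hx
        simp only [mem_compl, mem_union, not_or] at this ⊢
        exact this.1
      · simpa using hD' hiD
    simp only [hi, and_true]
    unfold avoidWeight at hle ⊢
    linarith
  · simp only [hi, and_false, filter_false, sum_empty, or_false]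
    split_ifs
    · linarith [avoidWeight_anti (subset_union_left (s₁ := A) (s₂ := {i, i + 1}))]
    · rfl

/-- One step of the dual chain on a function of finite sets of sites, at the edge `{i, i + 1}`:
if the edge misses `A` nothing happens; otherwise both of its sites join `A` with probability
`1 - p` and leave it with probability `p`. -/
noncomputable def dualStep (p : ℝ) (f : Finset (ZMod n) → ℝ) (A : Finset (ZMod n))
    (i : ZMod n) : ℝ :=
  if i ∈ A ∨ i + 1 ∈ A then (1 - p) * f (A ∪ {i, i + 1}) + p * f (A \ {i, i + 1}) else f A

lemma sum_dualStep_avoidWeight_le [NeZero n] (hn : 1 < n) {p : ℝ} (hp0 : 0 ≤ p)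
    (hp : p ≤ 1 / 20000) (A : Finset (ZMod n)) :
    ∑ i, dualStep p avoidWeight A i ≤ n * (avoidWeight A + (1 / 16) ^ n) := by
  have hterm : ∀ i, dualStep p avoidWeight A i ≤ avoidWeight A -
      (1 - p) * (if i ∈ A ∨ i + 1 ∈ A then
        avoidWeight A - avoidWeight (A ∪ {i, i + 1}) else 0) +
      p * (65 * pinnedWeight A i + pinnedWeight A (i + 1)) := by
    intro i
    unfold dualStep
    split_ifs with h
    · nlinarith [avoidWeight_sdiff_edge_le hn h]
    · have h0 := pinnedWeight_nonneg A i
      have h1 := pinnedWeight_nonneg A (i + 1)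
      nlinarith [mul_nonneg hp0 h0, mul_nonneg hp0 h1]
  have hshift : ∑ i, pinnedWeight A (i + 1) = ∑ i, pinnedWeight A i :=
    Equiv.sum_comp (Equiv.addRight (1 : ZMod n)) (pinnedWeight A)
  have hsum := sum_le_sum fun i (_ : i ∈ (univ : Finset (ZMod n))) => hterm i
  rw [sum_add_distrib, sum_sub_distrib, ← mul_sum, ← mul_sum, sum_add_distrib, ← mul_sum, hshift,
    sum_const, card_univ, ZMod.card, nsmul_eq_mul] at hsum
  have hloss := firstHitWeight_one_le A
  have hgain := sum_pinnedWeight_le A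
  have hF := firstHitWeight_nonneg A 1
  have hpow : (1 / 16 : ℝ) ^ (n - 1) = 16 * (1 / 16) ^ n := by
    obtain ⟨m, rfl⟩ : ∃ m, n = m + 1 := ⟨n - 1, by omega⟩
    rw [Nat.add_sub_cancel, pow_succ]
    ring
  rw [hpow] at hgain
  have hpow0 : (0 : ℝ) ≤ n * (1 / 16) ^ n := by positivity
  have h1 := mul_le_mul_of_nonneg_left hloss (by linarith : (0 : ℝ) ≤ 1 - p)
  have h2 := mul_le_mul_of_nonneg_left hgain hp0
  have h3 : p * (n * (1 / 16) ^ n) ≤ 1 / 20000 * (n * (1 / 16) ^ n) :=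
    mul_le_mul_of_nonneg_right hp hpow0
  have h4 : p * firstHitWeight A 1 ≤ 1 / 20000 * firstHitWeight A 1 :=
    mul_le_mul_of_nonneg_right hp hF
  linarith

/-- The event that all sites of `A` cooperate. -/
noncomputable def coopInd (A : Finset (ZMod n)) (S : Config n) : ℝ :=
  if ∀ x ∈ A, S x = true then 1 else 0

lemma coopInd_nonneg (A : Finset (ZMod n)) (S : Config n) : 0 ≤ coopInd A S := by
  unfold coopInd; split_ifs <;> norm_num

lemma coopInd_le_of_imp {A B : Finset (ZMod n)} {S T : Config n}
    (h : (∀ x ∈ A, S x = true) → ∀ x ∈ B, T x = true) : coopInd A S ≤ coopInd B T := by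
  unfold coopInd
  split_ifs with hA hB
  · rfl
  · exact absurd (h hA) hB
  all_goals norm_num

lemma coopInd_eq_zero {A : Finset (ZMod n)} {S : Config n} {x : ZMod n} (hx : x ∈ A)
    (hS : S x = false) : coopInd A S = 0 :=
  if_neg fun h => by simpa [hS] using h x hx

lemma rpUpdProb_nonneg {p : ℝ} (hp0 : 0 ≤ p) (hp1 : p ≤ 1) (S : Config n) (i : ZMod n)
    (T : Config n) : 0 ≤ rpUpdProb p S i T := by
  have : 0 ≤ 1 - p := by linarith
  unfold rpUpdProb
  split_ifs <;> positivity

lemma rpUpdProb_le_of_defect [NeZero n] {p : ℝ} (hp0 : 0 ≤ p) (hp1 : p ≤ 1) {S : Config n} {i : ZMod n}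
    (h : S i = false ∧ S (i + 1) = false) (T : Config n) :
    rpUpdProb p S i T ≤ ∑ b : Bool × Bool,
      if T = Function.update (Function.update S i b.1) (i + 1) b.2 then
        (if b.1 = true then p else 1 - p) * (if b.2 = true then p else 1 - p) else 0 := by
  have hq : 0 ≤ 1 - p := by linarith
  have hnn : ∀ b ∈ (univ : Finset (Bool × Bool)), 0 ≤
      if T = Function.update (Function.update S i b.1) (i + 1) b.2 then
        (if b.1 = true then p else 1 - p) * (if b.2 = true then p else 1 - p) else 0 :=
    fun b _ => by split_ifs <;> positivity
  unfold rpUpdProb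
  rw [if_neg (by simp [h.1]), if_pos h]
  split_ifs with hT
  all_goals try exact sum_nonneg hnn
  all_goals
    refine le_trans ?_ (single_le_sum hnn (mem_univ (T i, T (i + 1))))
    rw [if_pos]
    · simp [*]
    · funext j
      by_cases h1 : j = i + 1
      · subst h1; simp
      · by_cases h0 : j = i
        · subst h0; simp [Function.update_of_ne h1]
        · simp [Function.update_of_ne h1, Function.update_of_ne h0, hT j h0 h1]

lemma sum_rpUpdProb_mul_coopInd_le [NeZero n] (hn : 1 < n) {p : ℝ} (hp0 : 0 ≤ p) (hp1 : p ≤ 1)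
    (S : Config n) (i : ZMod n) (A : Finset (ZMod n)) :
    ∑ T, rpUpdProb p S i T * coopInd A T ≤ dualStep p (fun B => coopInd B S) A i := by
  have : Fact (1 < n) := ⟨hn⟩
  have hne : i ≠ i + 1 := by simp
  have hq : 0 ≤ 1 - p := by linarith
  by_cases hC : S i = true ∧ S (i + 1) = true
  · have hsum : ∑ T, rpUpdProb p S i T * coopInd A T = coopInd A S := by
      simp [rpUpdProb, hC]
    rw [hsum]
    unfold dualStep
    split_ifs
    · have h1 : coopInd A S ≤ coopInd (A ∪ {i, i + 1}) S := coopInd_le_of_imp fun h x hx => by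
        simp only [mem_union, mem_insert, mem_singleton] at hx
        rcases hx with hx | rfl | rfl
        exacts [h x hx, hC.1, hC.2]
      have h2 : coopInd A S ≤ coopInd (A \ {i, i + 1}) S :=
        coopInd_le_of_imp fun h x hx => h x (mem_sdiff.1 hx).1
      nlinarith
    · rfl
  by_cases hD : S i = false ∧ S (i + 1) = false
  · have hsum : ∑ T, rpUpdProb p S i T * coopInd A T ≤ ∑ b : Bool × Bool,
        ((if b.1 = true then p else 1 - p) * (if b.2 = true then p else 1 - p)) *
          coopInd A (Function.update (Function.update S i b.1) (i + 1) b.2) := by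
      calc _ ≤ ∑ T, (∑ b : Bool × Bool,
            if T = Function.update (Function.update S i b.1) (i + 1) b.2 then
              (if b.1 = true then p else 1 - p) * (if b.2 = true then p else 1 - p) else 0) *
            coopInd A T := sum_le_sum fun T _ =>
              mul_le_mul_of_nonneg_right (rpUpdProb_le_of_defect hp0 hp1 hD T) (coopInd_nonneg A T)
        _ = _ := by
          simp_rw [sum_mul]
          rw [sum_comm]
          refine sum_congr rfl fun b _ => ?_
          simp_rw [ite_mul, zero_mul]
          rw [sum_ite_eq' univ]
          simp
    refine hsum.trans ?_
    rw [Fintype.sum_prod_type]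
    simp only [Fintype.sum_bool, if_true, Bool.false_eq_true, if_false]
    have hle : ∀ b c, coopInd A (Function.update (Function.update S i b) (i + 1) c) ≤
        coopInd (A \ {i, i + 1}) S := fun b c => coopInd_le_of_imp fun h x hx => by
      simp only [mem_sdiff, mem_insert, mem_singleton, not_or] at hx
      simpa [Function.update_of_ne hx.2.1, Function.update_of_ne hx.2.2] using h x hx.1
    unfold dualStep
    have hF := coopInd_nonneg (A ∪ {i, i + 1}) S
    have htt := mul_le_mul_of_nonneg_left (hle true true) (mul_nonneg hp0 hp0)
    have htf := mul_le_mul_of_nonneg_left (hle true false) (mul_nonneg hp0 hq)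
    have hft := mul_le_mul_of_nonneg_left (hle false true) (mul_nonneg hq hp0)
    have hff := mul_le_mul_of_nonneg_left (hle false false) (mul_nonneg hq hq)
    by_cases hi : i ∈ A
    · have hz : ∀ c, coopInd A (Function.update (Function.update S i false) (i + 1) c) = 0 :=
        fun c => coopInd_eq_zero hi (by simp)
      rw [if_pos (Or.inl hi)]
      simp only [hz] at *
      nlinarith [mul_nonneg hq hF]
    by_cases hi' : i + 1 ∈ A
    · have hz : ∀ c, coopInd A (Function.update (Function.update S i c) (i + 1) false) = 0 :=
        fun c => coopInd_eq_zero hi' (by simp)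
      rw [if_pos (Or.inr hi')]
      simp only [hz] at *
      nlinarith [mul_nonneg hq hF]
    · rw [if_neg (by tauto)]
      have hA : A \ {i, i + 1} = A := sdiff_eq_self_of_disjoint (by simp [hi, hi'])
      rw [hA] at htt htf hft hff
      nlinarith
  · have hsum : ∑ T, rpUpdProb p S i T * coopInd A T =
        coopInd A (Function.update (Function.update S i false) (i + 1) false) := by
      simp only [rpUpdProb, if_neg hC, if_neg hD, ite_mul, one_mul, zero_mul]
      simp
    rw [hsum]
    unfold dualStep
    split_ifs with h
    · have : coopInd A (Function.update (Function.update S i false) (i + 1) false) = 0 := by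
        rcases h with h | h
        · exact coopInd_eq_zero h (by simp)
        · exact coopInd_eq_zero h (by simp)
      rw [this]
      have h1 := coopInd_nonneg (A ∪ {i, i + 1}) S
      have h2 := coopInd_nonneg (A \ {i, i + 1}) S
      positivity
    · refine coopInd_le_of_imp fun hT x hx => ?_
      have hx0 : x ≠ i := by rintro rfl; tauto
      have hx1 : x ≠ i + 1 := by rintro rfl; tauto
      simpa [Function.update_of_ne hx0, Function.update_of_ne hx1] using hT x hx

lemma rpStepProb_nonneg [NeZero n] {p : ℝ} (hp0 : 0 ≤ p) (hp1 : p ≤ 1) (S T : Config n) :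
    0 ≤ rpStepProb p S T :=
  mul_nonneg (by positivity) (sum_nonneg fun i _ => rpUpdProb_nonneg hp0 hp1 S i T)

lemma sum_rpStepProb_mul_coopInd_le [NeZero n] (hn : 1 < n) {p : ℝ} (hp0 : 0 ≤ p) (hp1 : p ≤ 1)
    (S : Config n) (A : Finset (ZMod n)) :
    ∑ T, rpStepProb p S T * coopInd A T ≤
      1 / (n : ℝ) * ∑ i, dualStep p (fun B => coopInd B S) A i := by
  calc ∑ T, rpStepProb p S T * coopInd A T
      = 1 / (n : ℝ) * ∑ i, ∑ T, rpUpdProb p S i T * coopInd A T := by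
        simp_rw [rpStepProb, mul_assoc, sum_mul, ← mul_sum]
        rw [sum_comm]
    _ ≤ _ := mul_le_mul_of_nonneg_left
        (sum_le_sum fun i _ => sum_rpUpdProb_mul_coopInd_le hn hp0 hp1 S i A) (by positivity)

lemma sum_rpStepProb_le_one [NeZero n] (hn : 1 < n) {p : ℝ} (hp0 : 0 ≤ p) (hp1 : p ≤ 1)
    (S : Config n) : ∑ T, rpStepProb p S T ≤ 1 := by
  have h := sum_rpStepProb_mul_coopInd_le hn hp0 hp1 S ∅
  have hn0 : (n : ℝ) ≠ 0 := by exact_mod_cast NeZero.ne n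
  simpa [coopInd, dualStep, ZMod.card, hn0] using h

/-- `μ` gives every event `A` cooperates mass at most `avoidWeight A + s (1/16)^n`. -/
def Dominated [NeZero n] (μ : Config n → ℝ) (s : ℕ) : Prop :=
  ∀ A, ∑ S, μ S * coopInd A S ≤ avoidWeight A + s * (1 / 16) ^ n

lemma Dominated.step [NeZero n] (hn : 1 < n) {p : ℝ} (hp0 : 0 ≤ p) (hp : p ≤ 1 / 20000)
    {μ : Config n → ℝ} {s : ℕ} (hμ0 : ∀ S, 0 ≤ μ S) (hμ : Dominated μ s) :
    Dominated (fun T => ∑ S, μ S * rpStepProb p S T) (s + 1) := by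
  intro A
  have hn0 : (0 : ℝ) < n := by exact_mod_cast NeZero.pos n
  have hq : 0 ≤ 1 - p := by linarith
  calc ∑ T, (∑ S, μ S * rpStepProb p S T) * coopInd A T
      = ∑ S, μ S * ∑ T, rpStepProb p S T * coopInd A T := by
        simp_rw [sum_mul, mul_sum, mul_assoc]
        rw [sum_comm]
    _ ≤ ∑ S, μ S * (1 / (n : ℝ) * ∑ i, dualStep p (fun B => coopInd B S) A i) :=
        sum_le_sum fun S _ => mul_le_mul_of_nonneg_left
          (sum_rpStepProb_mul_coopInd_le hn hp0 (by linarith) S A) (hμ0 S)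
    _ = 1 / (n : ℝ) * ∑ i, ∑ S, μ S * dualStep p (fun B => coopInd B S) A i := by
        simp_rw [mul_sum]
        rw [sum_comm]
        refine sum_congr rfl fun i _ => sum_congr rfl fun S _ => by ring
    _ ≤ 1 / (n : ℝ) * ∑ i, (dualStep p avoidWeight A i + s * (1 / 16) ^ n) := by
        refine mul_le_mul_of_nonneg_left (sum_le_sum fun i _ => ?_) (by positivity)
        unfold dualStep
        split_ifs
        · have h1 := mul_le_mul_of_nonneg_left (hμ (A ∪ {i, i + 1})) hq
          have h2 := mul_le_mul_of_nonneg_left (hμ (A \ {i, i + 1})) hp0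
          rw [mul_sum] at h1 h2
          have : ∑ S, μ S * ((1 - p) * coopInd (A ∪ {i, i + 1}) S +
              p * coopInd (A \ {i, i + 1}) S) =
              ∑ S, (1 - p) * (μ S * coopInd (A ∪ {i, i + 1}) S) +
              ∑ S, p * (μ S * coopInd (A \ {i, i + 1}) S) := by
            rw [← sum_add_distrib]
            exact sum_congr rfl fun S _ => by ring
          linarith
        · exact hμ A
    _ = 1 / (n : ℝ) * ∑ i, dualStep p avoidWeight A i + s * (1 / 16) ^ n := by
        rw [sum_add_distrib, sum_const, card_univ, ZMod.card, nsmul_eq_mul]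
        field_simp
    _ ≤ 1 / (n : ℝ) * (n * (avoidWeight A + (1 / 16) ^ n)) + s * (1 / 16) ^ n := by
        gcongr
        exact sum_dualStep_avoidWeight_le hn hp0 hp A
    _ = avoidWeight A + (s + 1 : ℕ) * (1 / 16) ^ n := by
        push_cast
        field_simp
        ring

lemma dominated_allDefect [NeZero n] :
    Dominated (fun S : Config n => if S = fun _ => false then (1 : ℝ) else 0) 0 := by
  intro A
  simp only [ite_mul, one_mul, zero_mul, Nat.cast_zero, add_zero]
  rw [sum_ite_eq' univ, if_pos (mem_univ _)]
  rcases A.eq_empty_or_nonempty with rfl | ⟨x, hx⟩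
  · simpa [coopInd] using one_le_avoidWeight_empty (n := n)
  · rw [coopInd_eq_zero hx rfl]
    exact avoidWeight_nonneg A

section Trajectories

variable [NeZero n] {p : ℝ}

lemma rpTrajProb_mono (hp0 : 0 ≤ p) (hp1 : p ≤ 1) (S0 : Config n) {t : ℕ}
    {E F : (Fin (t + 1) → Config n) → Prop} (h : ∀ σ, σ 0 = S0 → E σ → F σ) :
    rpTrajProb p S0 t E ≤ rpTrajProb p S0 t F := by
  refine sum_le_sum fun σ _ => ?_
  have hnn : 0 ≤ ∏ s : Fin t, rpStepProb p (σ s.castSucc) (σ s.succ) :=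
    prod_nonneg fun s _ => rpStepProb_nonneg hp0 hp1 _ _
  split_ifs with hE hF
  · rfl
  · exact absurd ⟨hE.1, h σ hE.1 hE.2⟩ hF
  · exact hnn
  · rfl

lemma rpTrajProb_succ (S0 : Config n) (t : ℕ) (E : (Fin (t + 1 + 1) → Config n) → Prop) :
    rpTrajProb p S0 (t + 1) E = ∑ S, rpStepProb p S0 S *
      rpTrajProb p S t fun τ => E (Fin.cons S0 τ : Fin (t + 1 + 1) → Config n) := by
  unfold rpTrajProb
  rw [← (Fin.consEquiv fun _ => Config n).sum_comp, Fintype.sum_prod_type]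
  simp_rw [mul_sum]
  rw [sum_comm, sum_comm (s := univ) (t := univ) (f := fun S τ => rpStepProb p S0 S * _)]
  refine sum_congr rfl fun τ _ => ?_
  rw [sum_eq_single S0, sum_eq_single (τ 0)]
  · simp [Fin.consEquiv, Fin.prod_univ_succ]
  · intro S _ hS
    simp [hS.symm]
  · simp
  · intro S _ hS
    simp [Fin.consEquiv, hS]
  · simp

lemma rpTrajProb_le_one (hn : 1 < n) (hp0 : 0 ≤ p) (hp1 : p ≤ 1) :
    ∀ (t : ℕ) (S0 : Config n) (E : (Fin (t + 1) → Config n) → Prop), rpTrajProb p S0 t E ≤ 1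
  | 0, S0, E => by
    refine (rpTrajProb_mono hp0 hp1 S0 (F := fun _ => True) fun _ _ _ => trivial).trans ?_
    unfold rpTrajProb
    rw [sum_eq_single fun _ => S0]
    · simp
    · intro σ _ hσ
      rw [if_neg]
      rintro ⟨h, -⟩
      exact hσ (funext fun i => by rw [Fin.fin_one_eq_zero i, h])
    · simp
  | t + 1, S0, E => by
    rw [rpTrajProb_succ]
    refine (sum_le_sum fun S _ => ?_).trans (sum_rpStepProb_le_one hn hp0 hp1 S0)
    exact mul_le_of_le_one_right (rpStepProb_nonneg hp0 hp1 _ _)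
      (rpTrajProb_le_one hn hp0 hp1 t S _)

lemma rpTrajProb_exists_zero (hn : 1 < n) (hp0 : 0 ≤ p) (hp1 : p ≤ 1) (B : Config n → Prop)
    (S0 : Config n) :
    rpTrajProb p S0 0 (fun σ => ∃ s, B (σ s)) ≤ if B S0 then 1 else 0 := by
  split_ifs with hB
  · exact rpTrajProb_le_one hn hp0 hp1 0 S0 _
  · refine (sum_eq_zero fun σ _ => if_neg ?_).le
    rintro ⟨h0, s, hs⟩
    rw [Fin.fin_one_eq_zero s, h0] at hs
    exact hB hs

lemma rpTrajProb_exists_succ (hn : 1 < n) (hp0 : 0 ≤ p) (hp1 : p ≤ 1) (B : Config n → Prop)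
    (S0 : Config n) (t : ℕ) :
    rpTrajProb p S0 (t + 1) (fun σ => ∃ s, B (σ s)) ≤ (if B S0 then 1 else 0) +
      ∑ S, rpStepProb p S0 S * rpTrajProb p S t (fun σ => ∃ s, B (σ s)) := by
  have hnn : 0 ≤ ∑ S, rpStepProb p S0 S * rpTrajProb p S t (fun σ => ∃ s, B (σ s)) := by
    refine sum_nonneg fun S _ => mul_nonneg (rpStepProb_nonneg hp0 hp1 _ _) ?_
    refine sum_nonneg fun σ _ => ?_
    split_ifs
    · exact prod_nonneg fun s _ => rpStepProb_nonneg hp0 hp1 _ _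
    · rfl
  split_ifs with hB
  · linarith [rpTrajProb_le_one hn hp0 hp1 (t + 1) S0 fun σ => ∃ s, B (σ s)]
  · rw [zero_add, rpTrajProb_succ]
    refine sum_le_sum fun S _ => mul_le_mul_of_nonneg_left ?_ (rpStepProb_nonneg hp0 hp1 _ _)
    refine rpTrajProb_mono hp0 hp1 S fun τ _ hτ => ?_
    obtain ⟨s, hs⟩ := hτ
    induction s using Fin.cases with
    | zero => exact absurd hs hB
    | succ s => exact ⟨s, hs⟩

/-- If an event is covered by cooperation of one of the sets `I x`, each of `avoidWeight` at most
`G`, then from a dominated initial law it is unlikely to be ever visited up to time `t`. -/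
lemma sum_mul_rpTrajProb_exists_le (hn : 1 < n) (hp0 : 0 ≤ p) (hp : p ≤ 1 / 20000)
    {B : Config n → Prop} {I : ZMod n → Finset (ZMod n)} {G : ℝ}
    (hB : ∀ S, B S → ∃ x, ∀ y ∈ I x, S y = true) (hG : ∀ x, avoidWeight (I x) ≤ G) :
    ∀ (t s : ℕ) (μ : Config n → ℝ), (∀ S, 0 ≤ μ S) → Dominated μ s →
      ∑ S, μ S * rpTrajProb p S t (fun σ => ∃ r, B (σ r)) ≤
        (t + 1) * (n * (G + (s + t : ℕ) * (1 / 16) ^ n)) := by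
  have hp1 : p ≤ 1 := by linarith
  have hbad : ∀ (s : ℕ) (μ : Config n → ℝ), (∀ S, 0 ≤ μ S) → Dominated μ s →
      ∑ S, μ S * (if B S then 1 else 0) ≤ n * (G + s * (1 / 16) ^ n) := by
    intro s μ hμ0 hμ
    calc ∑ S, μ S * (if B S then 1 else 0) ≤ ∑ S, μ S * ∑ x, coopInd (I x) S := by
          refine sum_le_sum fun S _ => mul_le_mul_of_nonneg_left ?_ (hμ0 S)
          have hnn : ∀ x ∈ (univ : Finset (ZMod n)), 0 ≤ coopInd (I x) S :=
            fun x _ => coopInd_nonneg _ _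
          split_ifs with h
          · obtain ⟨x, hx⟩ := hB S h
            refine le_trans ?_ (single_le_sum hnn (mem_univ x))
            rw [coopInd, if_pos hx]
          · exact sum_nonneg hnn
      _ = ∑ x, ∑ S, μ S * coopInd (I x) S := by
          simp_rw [mul_sum]
          rw [sum_comm]
      _ ≤ ∑ _x : ZMod n, (G + s * (1 / 16) ^ n) :=
          sum_le_sum fun x _ => (hμ (I x)).trans (by linarith [hG x])
      _ = n * (G + s * (1 / 16) ^ n) := by
          rw [sum_const, card_univ, ZMod.card, nsmul_eq_mul]
  intro t
  induction t with
  | zero =>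
    intro s μ hμ0 hμ
    refine le_trans (sum_le_sum fun S _ => mul_le_mul_of_nonneg_left
      (rpTrajProb_exists_zero hn hp0 hp1 B S) (hμ0 S)) ?_
    simpa using hbad s μ hμ0 hμ
  | succ t ih =>
    intro s μ hμ0 hμ
    have h1 := hbad s μ hμ0 hμ
    have h2 := ih (s + 1) _ (fun T => sum_nonneg fun S _ =>
      mul_nonneg (hμ0 S) (rpStepProb_nonneg hp0 hp1 S T)) (hμ.step hn hp0 hp hμ0)
    have h3 : ∑ S, μ S * rpTrajProb p S (t + 1) (fun σ => ∃ r, B (σ r)) ≤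
        ∑ S, μ S * (if B S then 1 else 0) + ∑ T, (∑ S, μ S * rpStepProb p S T) *
          rpTrajProb p T t (fun σ => ∃ r, B (σ r)) := by
      have : ∑ T, (∑ S, μ S * rpStepProb p S T) * rpTrajProb p T t (fun σ => ∃ r, B (σ r)) =
          ∑ S, μ S * ∑ T, rpStepProb p S T * rpTrajProb p T t (fun σ => ∃ r, B (σ r)) := by
        simp_rw [sum_mul, mul_sum, mul_assoc]
        rw [sum_comm]
      rw [this, ← sum_add_distrib]
      refine sum_le_sum fun S _ => ?_
      rw [← mul_add]
      exact mul_le_mul_of_nonneg_left (rpTrajProb_exists_succ hn hp0 hp1 B S t) (hμ0 S)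
    have h4 : (n : ℝ) * (G + s * (1 / 16) ^ n) ≤
        n * (G + (s + (t + 1) : ℕ) * (1 / 16) ^ n) := by
      gcongr
      omega
    have h5 : ((s + 1 + t : ℕ) : ℝ) = (s + (t + 1) : ℕ) := by congr 1; omega
    rw [h5] at h2
    push_cast at h2 h4 ⊢
    linarith

end Trajectories

/-- The `L` consecutive sites starting at `x`. -/
def arc (n L : ℕ) (x : ZMod n) : Finset (ZMod n) := (range L).image fun k : ℕ => x + (k : ZMod n)

lemma card_arc {L : ℕ} (hL : L ≤ n) (x : ZMod n) : (arc n L x).card = L := by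
  rw [arc, card_image_of_injOn, card_range]
  intro a ha b hb hab
  have h := (ZMod.natCast_eq_natCast_iff' a b n).1 (add_left_cancel hab)
  have ha' : a < L := by simpa using ha
  have hb' : b < L := by simpa using hb
  rwa [Nat.mod_eq_of_lt (by omega), Nat.mod_eq_of_lt (by omega)] at h

lemma avoidWeight_arc_le [NeZero n] (x : ZMod n) :
    avoidWeight (arc n ⌈(n : ℝ) / 4⌉₊ x) ≤ Real.exp (-(n / 2 : ℝ)) := by
  have hn0 : (0 : ℝ) < n := by exact_mod_cast NeZero.pos n
  set L := ⌈(n : ℝ) / 4⌉₊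
  have hLn : L ≤ n := Nat.ceil_le.2 (by linarith)
  have h4L : n ≤ 4 * L := by
    have := Nat.le_ceil ((n : ℝ) / 4)
    have : (n : ℝ) ≤ ((4 * L : ℕ) : ℝ) := by push_cast; linarith
    exact_mod_cast this
  have hexp : (17 / 32 : ℝ) ≤ Real.exp (-(1 / 2)) := by
    have := Real.one_sub_le_exp_neg (1 / 8 : ℝ)
    have h4 : Real.exp (-(1 / 2)) = Real.exp (-(1 / 8)) ^ 4 := by
      rw [← Real.exp_nat_mul]; norm_num
    rw [h4]
    calc (17 / 32 : ℝ) ≤ (1 - 1 / 8) ^ 4 := by norm_num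
      _ ≤ _ := by gcongr
  calc avoidWeight (arc n L x)
      ≤ (1 / 16) ^ (arc n L x).card * (17 / 16) ^ ((arc n L x)ᶜ).card := avoidWeight_le _
    _ ≤ (1 / 2) ^ n * (17 / 16) ^ n := by
        rw [card_arc hLn]
        refine mul_le_mul ?_ ?_ (by positivity) (by positivity)
        · rw [show (1 / 16 : ℝ) = (1 / 2) ^ 4 by norm_num, ← pow_mul]
          exact pow_le_pow_of_le_one (by norm_num) (by norm_num) h4L
        · refine pow_le_pow_right₀ (by norm_num) ?_
          simpa [ZMod.card] using card_le_univ (arc n L x)ᶜ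
    _ = (17 / 32) ^ n := by rw [← mul_pow]; norm_num
    _ ≤ Real.exp (-(1 / 2)) ^ n := by gcongr
    _ = Real.exp (-(n / 2 : ℝ)) := by rw [← Real.exp_nat_mul]; congr 1; ring

lemma time_mul_bound_le {n : ℕ} (hn : 20000 ≤ n) :
    ((⌈Real.exp (1 / 100 * n)⌉₊ : ℝ) + 1) *
      (n * (Real.exp (-(n / 2 : ℝ)) + ⌈Real.exp (1 / 100 * n)⌉₊ * (1 / 16) ^ n)) ≤
      Real.exp (-(1 / 100 * n)) := by
  have hnR : (20000 : ℝ) ≤ n := by exact_mod_cast hn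
  set E := Real.exp (1 / 100 * n) with hE
  have hE1 : 1 ≤ E := Real.one_le_exp (by positivity)
  have hT : (⌈E⌉₊ : ℝ) ≤ 2 * E := by linarith [Nat.ceil_lt_add_one (by linarith : 0 ≤ E)]
  have h16 : (1 / 16 : ℝ) ^ n ≤ Real.exp (-n) := by
    have : (1 / 16 : ℝ) ≤ Real.exp (-1) := by
      rw [Real.exp_neg, ← one_div]
      exact one_div_le_one_div_of_le (Real.exp_pos _) (by linarith [Real.exp_one_lt_d9])
    calc (1 / 16 : ℝ) ^ n ≤ Real.exp (-1) ^ n := by gcongr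
      _ = Real.exp (-n) := by rw [← Real.exp_nat_mul]; congr 1; ring
  have hEn : E * Real.exp (-n) ≤ Real.exp (-(n / 2 : ℝ)) := by
    rw [hE, ← Real.exp_add]
    exact Real.exp_le_exp.2 (by linarith)
  have hlin : 9 * (n : ℝ) ≤ Real.exp (n / 4) := by
    have := Real.quadratic_le_exp_of_nonneg (by positivity : (0 : ℝ) ≤ n / 4)
    nlinarith
  calc ((⌈E⌉₊ : ℝ) + 1) * (n * (Real.exp (-(n / 2 : ℝ)) + ⌈E⌉₊ * (1 / 16) ^ n))
      ≤ (3 * E) * (n * (Real.exp (-(n / 2 : ℝ)) + 2 * E * Real.exp (-n))) := by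
        gcongr
        linarith
    _ ≤ (3 * E) * (n * (3 * Real.exp (-(n / 2 : ℝ)))) := by
        gcongr
        linarith
    _ = (9 * n) * (E * Real.exp (-(n / 2 : ℝ))) := by ring
    _ ≤ Real.exp (n / 4) * (E * Real.exp (-(n / 2 : ℝ))) := by gcongr
    _ = Real.exp (n / 4 + (1 / 100 * n + -(n / 2))) := by rw [Real.exp_add, Real.exp_add]
    _ ≤ Real.exp (-(1 / 100 * n)) := Real.exp_le_exp.2 (by linarith)

end RationalPavlov

/-- **No long cooperator runs in polynomial time.**
There are constants `p₁ > 0` and `c > 0` such that for every `p ∈ (0, p₁]` and every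
sufficiently large `n` (in particular `n ≥ e^{1/p}`): starting from the all-defect
configuration, the probability that at some time `t ≤ e^{c·n}` the configuration
contains at least `⌈n/4⌉` cyclically consecutive vertices in state `true`
is at most `e^{-c·n}`. -/
theorem rp_no_long_cooperator_runs :
    ∃ p₁ : ℝ, 0 < p₁ ∧ ∃ c : ℝ, 0 < c ∧
      ∀ p : ℝ, p ∈ Set.Ioc (0 : ℝ) p₁ →
        ∀ (n : ℕ) [NeZero n], Real.exp (1 / p) ≤ (n : ℝ) →
          rpTrajProb p (n := n) (fun _ => false) ⌈Real.exp (c * n)⌉₊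
            (fun σ => ∃ s : Fin (⌈Real.exp (c * n)⌉₊ + 1),
              (s : ℝ) ≤ Real.exp (c * n) ∧
                ∃ i : ZMod n, ∀ k : ℕ, k < ⌈(n : ℝ) / 4⌉₊ → σ s (i + (k : ZMod n)) = true)
          ≤ Real.exp (-(c * n)) := by
  refine ⟨1 / 20000, by norm_num, 1 / 100, by norm_num, fun p hp n _ hn => ?_⟩
  obtain ⟨hp0, hp1⟩ := hp
  have hn20000 : 20000 ≤ n := by
    have h1 : (20000 : ℝ) ≤ 1 / p := by
      rw [le_div_iff₀ hp0]
      linarith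
    have h2 := Real.add_one_le_exp (1 / p)
    have : (20000 : ℝ) ≤ n := by linarith
    exact_mod_cast this
  refine (RationalPavlov.rpTrajProb_mono hp0.le (by linarith) _
    (F := fun σ => ∃ s, ∃ i : ZMod n, ∀ k : ℕ, k < ⌈(n : ℝ) / 4⌉₊ → σ s (i + (k : ZMod n)) = true)
    fun σ _ ⟨s, _, h⟩ => ⟨s, h⟩).trans ?_
  have h := RationalPavlov.sum_mul_rpTrajProb_exists_le (by omega) hp0.le hp1
    (B := fun S : Config n => ∃ i : ZMod n, ∀ k : ℕ, k < ⌈(n : ℝ) / 4⌉₊ →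
      S (i + (k : ZMod n)) = true)
    (I := RationalPavlov.arc n ⌈(n : ℝ) / 4⌉₊)
    (fun S ⟨i, hi⟩ => ⟨i, fun y hy => by
      obtain ⟨k, hk, rfl⟩ := Finset.mem_image.1 hy
      exact hi k (Finset.mem_range.1 hk)⟩)
    RationalPavlov.avoidWeight_arc_le ⌈Real.exp (1 / 100 * n)⌉₊ 0 _
    (fun S => by split_ifs <;> norm_num) RationalPavlov.dominated_allDefect
  simp only [ite_mul, one_mul, zero_mul] at h
  rw [Finset.sum_ite_eq' Finset.univ, if_pos (Finset.mem_univ _), zero_add] at h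
  exact h.trans (RationalPavlov.time_mul_bound_le hn20000)
end

section
/- Theorem (emergence of defection for p = 0). Consider the RP chain with p = 0 started from a configuration with exactly one vertex in state false, and let T = min{t ≥ 0 : S_t is the constant-false configuration}. There exists a constant C > 0 such that the probability of the event n(n−1)/2 − C·n^{3/2}·log n ≤ T ≤ n(n−1)/2 + C·n^{3/2}·log n tends to 1 as n → ∞. -/
open scoped Classical

/-- The deterministic result of playing the edge `{i, i+1}` when `p = 0`. -/
noncomputable def zeroUpd {n : ℕ} (S : Config n) (i : ZMod n) : Config n :=
  if S i = S (i + 1) then S else Function.update (Function.update S i false) (i + 1) false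

lemma rpUpdProb_zero {n : ℕ} (S : Config n) (i : ZMod n) (T : Config n) :
    rpUpdProb 0 S i T = if T = zeroUpd S i then 1 else 0 := by
  unfold rpUpdProb zeroUpd
  cases h1 : S i <;> cases h2 : S (i + 1) <;> simp
  by_cases hT : T = S
  · subst hT
    simp [h1, h2]
  · rw [if_neg hT]
    by_cases h3 : T i = true
    · simp [h3]
    by_cases h4 : T (i + 1) = true
    · simp [h4]
    rw [if_neg]
    intro h
    refine hT (funext fun j => ?_)
    by_cases hj : j = i
    · subst hj; simp_all
    by_cases hj' : j = i + 1
    · subst hj'; simp_all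
    exact h j hj hj'

lemma sum_rpStepProb_zero_mul {n : ℕ} [NeZero n] (S : Config n) (f : Config n → ℝ) :
    ∑ T, rpStepProb 0 S T * f T = (1 / (n : ℝ)) * ∑ i, f (zeroUpd S i) := by
  simp only [rpStepProb, rpUpdProb_zero, mul_assoc, Finset.sum_mul, ← Finset.mul_sum]
  rw [Finset.sum_comm]
  simp

lemma rpStepProb_zero_nonneg {n : ℕ} [NeZero n] (S T : Config n) : 0 ≤ rpStepProb 0 S T := by
  simp only [rpStepProb, rpUpdProb_zero]
  positivity

/-- First-step decomposition of trajectory probabilities. -/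
lemma rpTrajProb_succ {n : ℕ} [NeZero n] (p : ℝ) (S : Config n) (t : ℕ)
    (E : (Fin (t + 2) → Config n) → Prop) :
    rpTrajProb p S (t + 1) E =
      ∑ T, rpStepProb p S T *
        rpTrajProb p T t (fun τ => E (Fin.cons (α := fun _ => Config n) S τ)) := by
  unfold rpTrajProb
  rw [← (Fin.consEquiv (fun _ : Fin (t + 2) => Config n)).sum_comp, Fintype.sum_prod_type,
    Fintype.sum_eq_single S]
  · simp only [Finset.mul_sum]
    rw [Finset.sum_comm]
    refine Finset.sum_congr rfl fun τ _ => ?_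
    rw [Fintype.sum_eq_single (τ 0)]
    · simp [Fin.consEquiv, Fin.prod_univ_succ]
    · intro T hT
      rw [if_neg (fun h => hT h.1.symm), mul_zero]
  · intro T hT
    refine Finset.sum_eq_zero fun τ _ => if_neg ?_
    rintro ⟨h, -⟩
    exact hT (by simpa [Fin.consEquiv] using h)

lemma rpTrajProb_zero_nonneg {n : ℕ} [NeZero n] (S : Config n) (t : ℕ)
    (E : (Fin (t + 1) → Config n) → Prop) : 0 ≤ rpTrajProb 0 S t E := by
  refine Finset.sum_nonneg fun σ _ => ?_
  split_ifs
  · exact Finset.prod_nonneg fun _ _ => rpStepProb_zero_nonneg _ _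
  · exact le_rfl

lemma rpTrajProb_zero_true {n : ℕ} [NeZero n] (S : Config n) (t : ℕ) :
    rpTrajProb 0 S t (fun _ => True) = 1 := by
  induction t generalizing S with
  | zero =>
    unfold rpTrajProb
    rw [Fintype.sum_eq_single (fun _ => S)]
    · simp
    · intro σ hσ
      refine if_neg fun h => hσ (funext fun j => ?_)
      rw [Fin.fin_one_eq_zero j, h.1]
  | succ t ih =>
    rw [rpTrajProb_succ]
    simp only [ih]
    rw [sum_rpStepProb_zero_mul S fun _ => 1]
    simp [ZMod.card, NeZero.ne n]

lemma rpTrajProb_zero_eq_one {n : ℕ} [NeZero n] (S : Config n) (t : ℕ)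
    (E : (Fin (t + 1) → Config n) → Prop) (h : ∀ σ, σ 0 = S → E σ) :
    rpTrajProb 0 S t E = 1 := by
  rw [← rpTrajProb_zero_true S t]
  unfold rpTrajProb
  refine Finset.sum_congr rfl fun σ _ => ?_
  by_cases h0 : σ 0 = S
  · simp [h0, h σ h0]
  · simp [h0]

/-- The configuration whose defectors are the `k` consecutive vertices starting at `a`. -/
noncomputable def arc {n : ℕ} (a : ZMod n) (k : ℕ) : Config n :=
  fun j => decide (k ≤ (j - a).val)

lemma val_add_one_sub {n : ℕ} [NeZero n] (hn : 3 ≤ n) (i a : ZMod n) :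
    (i + 1 - a).val = if (i - a).val + 1 = n then 0 else (i - a).val + 1 := by
  have h1 : (1 : ZMod n).val = 1 := by
    rw [ZMod.val_one_eq_one_mod, Nat.mod_eq_of_lt (by omega)]
  have hlt := ZMod.val_lt (i - a)
  rw [show i + 1 - a = (i - a) + 1 by ring, ZMod.val_add, h1]
  split_ifs with h
  · rw [h, Nat.mod_self]
  · exact Nat.mod_eq_of_lt (by omega)

lemma zeroUpd_arc_right {n : ℕ} [NeZero n] (hn : 3 ≤ n) (a i : ZMod n) {k : ℕ} (hk : k + 1 < n)
    (hi : (i - a).val = k) : zeroUpd (arc a (k + 1)) i = arc a (k + 2) := by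
  have hs := val_add_one_sub hn i a
  rw [if_neg (by omega)] at hs
  rw [zeroUpd, if_neg (by simp [arc, hs, hi])]
  funext j
  by_cases hj : j = i + 1
  · subst hj; simp [arc, hs, hi]
  have hj1 : (j - a).val ≠ k + 1 := fun h =>
    hj (sub_left_injective (b := a) (ZMod.val_injective n (by simp only [hs, hi, h])))
  rw [Function.update_of_ne hj]
  by_cases hj' : j = i
  · subst hj'; simp [arc, hi]
  rw [Function.update_of_ne hj']
  simp only [arc, decide_eq_decide]
  omega

lemma zeroUpd_arc_left {n : ℕ} [NeZero n] (hn : 3 ≤ n) (a i : ZMod n) {k : ℕ} (hk : k + 1 < n)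
    (hi : i + 1 = a) : zeroUpd (arc a (k + 1)) i = arc i (k + 2) := by
  subst hi
  have key : ∀ j, (j - i).val = if (j - (i + 1)).val + 1 = n then 0
      else (j - (i + 1)).val + 1 := fun j => by
    rw [← val_add_one_sub hn, add_sub_add_right_eq_sub]
  have hi := key i
  have hlt := ZMod.val_lt (i - (i + 1))
  have hi' : (i - (i + 1)).val + 1 = n := by
    by_contra h
    rw [if_neg h] at hi
    simp at hi
  have hne : ¬ arc (i + 1) (k + 1) i = arc (i + 1) (k + 1) (i + 1) := by
    simp only [arc, decide_eq_decide, sub_self, ZMod.val_zero]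
    omega
  rw [zeroUpd, if_neg hne]
  funext j
  by_cases hj : j = i + 1
  · subst hj; have := key (i + 1); simp [arc] at *; rw [this]; split_ifs <;> omega
  rw [Function.update_of_ne hj]
  by_cases hj' : j = i
  · subst hj'; simp [arc]
  rw [Function.update_of_ne hj']
  have hj1 : (j - (i + 1)).val + 1 ≠ n := fun h =>
    hj' (sub_left_injective (b := i + 1) (ZMod.val_injective n (by simp only; omega)))
  simp only [arc, decide_eq_decide]
  rw [key j, if_neg hj1]
  omega

lemma zeroUpd_arc_of_ne {n : ℕ} [NeZero n] (hn : 3 ≤ n) (a i : ZMod n) {k : ℕ}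
    (hi : (i - a).val ≠ k) (hi' : i + 1 ≠ a) : zeroUpd (arc a (k + 1)) i = arc a (k + 1) := by
  have hs := val_add_one_sub hn i a
  have h0 : (i + 1 - a).val ≠ 0 := by
    rw [Ne, ZMod.val_eq_zero, sub_eq_zero]
    exact hi'
  rw [if_neg (fun h => h0 (by rw [hs, if_pos h]))] at hs
  refine if_pos ?_
  simp only [arc, decide_eq_decide]
  omega

/-- One step of the chain from an arc grows the arc with probability `2 / n`. -/
lemma sum_rpStepProb_arc {n : ℕ} [NeZero n] (hn : 3 ≤ n) (a : ZMod n) {k : ℕ} (hk : k + 1 < n)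
    (f : Config n → ℝ) (g : ℕ → ℝ) (hf : ∀ b m, m + 1 ≤ n → g (m + 1) ≤ f (arc b (m + 1))) :
    (1 / (n : ℝ)) * (2 * g (k + 2) + ((n : ℝ) - 2) * g (k + 1)) ≤
      ∑ T, rpStepProb 0 (arc a (k + 1)) T * f T := by
  rw [sum_rpStepProb_zero_mul]
  refine mul_le_mul_of_nonneg_left ?_ (by positivity)
  have hv : ((k : ZMod n)).val = k := ZMod.val_cast_of_lt (by omega)
  have hne : (k : ZMod n) + a ≠ a - 1 := by
    intro h
    have h2 : ((k + 1 : ℕ) : ZMod n) = 0 := by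
      push_cast
      linear_combination h
    have := congrArg ZMod.val h2
    rw [ZMod.val_cast_of_lt hk] at this
    simp at this
  calc 2 * g (k + 2) + ((n : ℝ) - 2) * g (k + 1)
      = ∑ i : ZMod n, (g (k + 1) + (if i = (k : ZMod n) + a then g (k + 2) - g (k + 1) else 0)
          + (if i = a - 1 then g (k + 2) - g (k + 1) else 0)) := by
        simp [Finset.sum_add_distrib, ZMod.card]
        ring
    _ ≤ _ := by
        refine Finset.sum_le_sum fun i _ => ?_
        by_cases h1 : i = (k : ZMod n) + a
        · rw [if_pos h1, if_neg (h1 ▸ hne), zeroUpd_arc_right hn a i hk (by simp [h1, hv])]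
          linarith [hf a (k + 1) (by omega)]
        by_cases h2 : i = a - 1
        · rw [if_neg h1, if_pos h2, zeroUpd_arc_left hn a i hk (by simp [h2])]
          linarith [hf i (k + 1) (by omega)]
        · rw [if_neg h1, if_neg h2, zeroUpd_arc_of_ne hn a i
            (fun h => h1 ?_) (fun h => h2 (eq_sub_of_add_eq h))]
          · linarith [hf a k (by omega)]
          · rw [← h, ZMod.natCast_zmod_val]; ring

/-- Trajectories that first reach all-defect at a time in `[c - D, c + D]`. -/
def HitsNear {n t : ℕ} (c D : ℝ) (σ : Fin (t + 1) → Config n) : Prop :=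
  ∃ s : Fin (t + 1), σ s = (fun _ => false) ∧ c - D ≤ (s : ℝ) ∧ (s : ℝ) ≤ c + D ∧
    ∀ r : Fin (t + 1), r < s → σ r ≠ fun _ => false

lemma hitsNear_cons {n t : ℕ} (c D : ℝ) {S : Config n} (hS : S ≠ fun _ => false)
    (τ : Fin (t + 1) → Config n) :
    HitsNear c D (Fin.cons (α := fun _ => Config n) S τ : Fin (t + 2) → Config n) ↔
      HitsNear (c - 1) D τ := by
  unfold HitsNear
  rw [Fin.exists_fin_succ]
  simp only [Fin.cons_zero, hS, false_and, false_or, Fin.cons_succ, Fin.forall_fin_succ,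
    Fin.succ_lt_succ_iff, Fin.val_succ, Nat.cast_add, Nat.cast_one]
  refine exists_congr fun s => and_congr_right fun _ => and_congr ?_ (and_congr ?_ ?_)
  · constructor <;> intro h <;> linarith
  · constructor <;> intro h <;> linarith
  · simp [hS]

lemma arc_eq_false {n : ℕ} [NeZero n] (a : ZMod n) : arc a n = fun _ => false := by
  funext j
  simpa [arc] using ZMod.val_lt (j - a)

lemma arc_ne_false {n : ℕ} [NeZero n] (a : ZMod n) {k : ℕ} (hk : k < n) :
    arc a k ≠ fun _ => false := by
  intro h
  have := congrFun h (k + a)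
  simp [arc, ZMod.val_cast_of_lt hk] at this

/-- Second moment about `c` of the time needed to absorb an arc of length `k`. -/
noncomputable def hitMoment (n : ℕ) (c : ℝ) (k : ℕ) : ℝ :=
  ((n : ℝ) / 2 * ((n : ℝ) - k) - c) ^ 2 + ((n : ℝ) - k) * ((n : ℝ) / 2 * ((n : ℝ) / 2 - 1))

/-- Chebyshev's inequality for the absorption time of an arc. -/
lemma le_rpTrajProb_hitsNear {n : ℕ} [NeZero n] (hn : 3 ≤ n) {D : ℝ} (hD : 0 < D) (t : ℕ)
    (c : ℝ) (a : ZMod n) (k : ℕ) (hk : k + 1 ≤ n) (ht : c + D ≤ t) :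
    1 - hitMoment n c (k + 1) / D ^ 2 ≤ rpTrajProb 0 (arc a (k + 1)) t (HitsNear c D) := by
  have hn' : (3 : ℝ) ≤ n := by exact_mod_cast hn
  have hn2 : (0 : ℝ) ≤ (n : ℝ) / 2 - 1 := by linarith
  have of_le : D ^ 2 ≤ ((n : ℝ) / 2 * ((n : ℝ) - (k + 1 : ℕ)) - c) ^ 2 →
      1 - hitMoment n c (k + 1) / D ^ 2 ≤ rpTrajProb 0 (arc a (k + 1)) t (HitsNear c D) := by
    intro h
    refine le_trans ?_ (rpTrajProb_zero_nonneg _ _ _)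
    rw [sub_nonpos, one_le_div (by positivity)]
    have hk' : (0 : ℝ) ≤ (n : ℝ) - (k + 1 : ℕ) := sub_nonneg.2 (by exact_mod_cast hk)
    have : 0 ≤ ((n : ℝ) - (k + 1 : ℕ)) * ((n : ℝ) / 2 * ((n : ℝ) / 2 - 1)) := by positivity
    unfold hitMoment
    linarith
  rcases hk.eq_or_lt with hkn | hkn
  · by_cases hc : c - D ≤ 0 ∧ 0 ≤ c + D
    · rw [rpTrajProb_zero_eq_one]
      · rw [sub_le_self_iff, hitMoment, hkn]
        simp only [sub_self]
        positivity
      · intro σ hσ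
        exact ⟨0, by rw [hσ, hkn, arc_eq_false], by simpa using hc.1, by simpa using hc.2,
          fun r hr => absurd hr (Fin.not_lt_zero r)⟩
    · refine of_le ?_
      rw [hkn, sub_self, mul_zero, zero_sub, neg_sq, sq_le_sq, abs_of_pos hD, le_abs]
      by_contra! h
      exact hc ⟨by linarith, by linarith⟩
  · cases t with
    | zero =>
      refine of_le (pow_le_pow_left₀ hD.le ?_ 2)
      have hk' : (0 : ℝ) ≤ (n : ℝ) - (k + 1 : ℕ) := sub_nonneg.2 (by exact_mod_cast hk)
      have : 0 ≤ (n : ℝ) / 2 * ((n : ℝ) - (k + 1 : ℕ)) := by positivity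
      push_cast at ht this ⊢
      linarith
    | succ t =>
      rw [rpTrajProb_succ]
      simp only [hitsNear_cons c D (arc_ne_false a hkn)]
      refine le_trans (le_of_eq ?_) (sum_rpStepProb_arc hn a hkn _
        (fun m => 1 - hitMoment n (c - 1) m / D ^ 2) fun b m hm =>
          le_rpTrajProb_hitsNear hn hD t (c - 1) b m hm (by push_cast at ht; linarith))
      simp only [hitMoment]
      push_cast
      field_simp
      ring

/-- **Emergence of defection for `p = 0`.**
Started from a configuration with exactly one defector, the first hitting time `T` of the
all-defect configuration satisfies `n(n-1)/2 - C·n^{3/2}·log n ≤ T ≤ n(n-1)/2 + C·n^{3/2}·log n`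
with probability tending to `1` as `n → ∞`. (The event is expressed on trajectories of
length `⌈hi⌉₊`: at some time `s` in the window `[lo, hi]` the chain is in the all-defect
configuration, having never been there before.) -/
theorem rp_defection_time :
    ∃ C : ℝ, 0 < C ∧
      ∀ ε : ℝ, 0 < ε → ∃ N : ℕ, ∀ (n : ℕ) [NeZero n], N ≤ n →
        ∀ S0 : Config n, (∃! i : ZMod n, S0 i = false) →
          ∀ lo hi : ℝ,
            lo = (n : ℝ) * ((n : ℝ) - 1) / 2 - C * (n : ℝ) ^ ((3 : ℝ) / 2) * Real.log n →
            hi = (n : ℝ) * ((n : ℝ) - 1) / 2 + C * (n : ℝ) ^ ((3 : ℝ) / 2) * Real.log n →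
            1 - ε ≤
              rpTrajProb 0 S0 ⌈hi⌉₊
                (fun σ => ∃ s : Fin (⌈hi⌉₊ + 1),
                  σ s = (fun _ => false) ∧ lo ≤ (s : ℝ) ∧ (s : ℝ) ≤ hi ∧
                    ∀ r : Fin (⌈hi⌉₊ + 1), r < s → σ r ≠ fun _ => false) := by
  refine ⟨1, one_pos, fun ε hε => ?_⟩
  have hlog : ∀ᶠ n : ℕ in Filter.atTop, 1 + 1 / ε ≤ Real.log n :=
    (Real.tendsto_log_atTop.comp tendsto_natCast_atTop_atTop).eventually_ge_atTop _
  obtain ⟨N, hN⟩ := Filter.eventually_atTop.1 hlog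
  refine ⟨max N 3, fun n _ hn S0 ⟨a, ha, ha'⟩ lo hi hlo hhi => ?_⟩
  have hn3 : 3 ≤ n := (le_max_right _ _).trans hn
  have hL := hN n ((le_max_left _ _).trans hn)
  have hn' : (3 : ℝ) ≤ n := by exact_mod_cast hn3
  have hε' : 0 < 1 / ε := by positivity
  have hL0 : 0 < Real.log n := by linarith
  have hS0 : S0 = arc a (0 + 1) := by
    funext j
    have h : (j - a).val = 0 ↔ j = a := by rw [ZMod.val_eq_zero, sub_eq_zero]
    by_cases hj : j = a
    · subst hj; simp [arc, ha]
    · have h1 : S0 j = true := by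
        by_contra h'
        exact hj (ha' j (by simpa using h'))
      rw [h1]
      simp only [arc, Bool.true_eq, decide_eq_true_eq]
      have := mt h.1 hj
      omega
  set D : ℝ := 1 * (n : ℝ) ^ ((3 : ℝ) / 2) * Real.log n with hDdef
  have hD : 0 < D := by positivity
  have hD2 : D ^ 2 = (n : ℝ) ^ 3 * Real.log n ^ 2 := by
    rw [hDdef, one_mul, mul_pow, ← Real.rpow_natCast, ← Real.rpow_mul (by positivity)]
    norm_num
  have key := le_rpTrajProb_hitsNear hn3 hD ⌈hi⌉₊ ((n : ℝ) * ((n : ℝ) - 1) / 2) a 0 (by omega)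
    (hhi ▸ Nat.le_ceil _)
  have hbound : hitMoment n ((n : ℝ) * ((n : ℝ) - 1) / 2) (0 + 1) / D ^ 2 ≤ ε := by
    have h1 : hitMoment n ((n : ℝ) * ((n : ℝ) - 1) / 2) (0 + 1) ≤ (n : ℝ) ^ 3 := by
      unfold hitMoment
      push_cast
      nlinarith [sq_nonneg (n : ℝ), pow_pos (by linarith : (0 : ℝ) < n) 3]
    have h2 : 1 ≤ ε * Real.log n ^ 2 := by
      have : 1 ≤ ε * Real.log n := by
        rw [mul_comm, ← div_le_iff₀ hε]
        linarith
      nlinarith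
    rw [div_le_iff₀ (by positivity), hD2]
    nlinarith [pow_pos (by linarith : (0 : ℝ) < n) 3]
  rw [hS0]
  subst hlo hhi
  exact (sub_le_sub_left hbound 1).trans key
end
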